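/- arXiv:0710.3928 — 2 statements merged into one kernel-verified Lean document; each statement's English description precedes it below -/
import Mathlib

section
/- There exist constants C0 > 0, c > 0 and C > 0 such that for every δ > 0 there is N such that for every n ≥ N divisible by 3 and every p with n·p ≥ C0, with probability at least 1 − δ a sample G ~ 𝒢_{n,p,3} admits an (n·p)-core D ⊆ V with |D| ≥ (1 − e^{−c·n·p})·n such that every connected component of the induced subgraph G[V ∖ D] has at most C·log n vertices. -/
open MeasureTheory

/-- The balanced planted 3-coloring on `Fin n`: vertex `v` gets color `v mod 3`. -/
def plantedColoring (n : ℕ) (v : Fin n) : Fin 3 := ⟨v.val % 3, Nat.mod_lt _ (by norm_num)⟩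

/-- A pair of vertices is bichromatic if its two endpoints get distinct planted colors. -/
def Bichrom (n : ℕ) (e : Sym2 (Fin n)) : Prop :=
  Sym2.lift ⟨fun u v => plantedColoring n u ≠ plantedColoring n v,
    fun u v => propext ne_comm⟩ e

/-- The type of bichromatic pairs. -/
abbrev BichromPair (n : ℕ) : Type := {e : Sym2 (Fin n) // Bichrom n e}

noncomputable instance (n : ℕ) : Fintype (BichromPair n) := Fintype.ofFinite _

/-- The Bernoulli measure on `Bool` with parameter `p`. -/
noncomputable def bernoulliMeasure (p : ℝ) : Measure Bool :=
  ENNReal.ofReal p • Measure.dirac true + ENNReal.ofReal (1 - p) • Measure.dirac false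

/-- The planted 3-coloring distribution `𝒢_{n,p,3}`: the product over all bichromatic
pairs of Bernoulli(p) measures on `Bool`. -/
noncomputable def plantedMeasure (n : ℕ) (p : ℝ) : Measure (BichromPair n → Bool) :=
  Measure.pi fun _ => bernoulliMeasure p

/-- The graph of a sample point `ω`: its edges are the bichromatic pairs `e` with
`ω e = true`. -/
def plantedGraph (n : ℕ) (ω : BichromPair n → Bool) : SimpleGraph (Fin n) :=
  SimpleGraph.fromEdgeSet {e : Sym2 (Fin n) | ∃ h : Bichrom n e, ω ⟨e, h⟩ = true}

/-- `e(S)`: the number of edges of `G` with both endpoints in `S`. -/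
noncomputable def edgeCount {V : Type*} (G : SimpleGraph V) (S : Set V) : ℕ :=
  {e : Sym2 V | e ∈ G.edgeSet ∧ ∀ v ∈ e, v ∈ S}.ncard

/-- `D` is a `d`-core: every `v ∈ D` has at least `d/5` neighbors in `D ∩ V_i` for
each color class index `i ≠ φ*(v)`, and at most `d/20` neighbors outside `D`. -/
def IsCore (n : ℕ) (G : SimpleGraph (Fin n)) (d : ℝ) (D : Set (Fin n)) : Prop :=
  ∀ v ∈ D,
    (∀ i : Fin 3, i ≠ plantedColoring n v →
      d / 5 ≤ ({w : Fin n | G.Adj v w ∧ w ∈ D ∧ plantedColoring n w = i}.ncard : ℝ)) ∧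
    ({w : Fin n | G.Adj v w ∧ w ∉ D}.ncard : ℝ) ≤ d / 20

/-- `c_t(u,v,m)`: the number of neighbors `w` of `u` other than `v` with `m(w→u) = some t`. -/
noncomputable def msgCount {V : Type*} (G : SimpleGraph V)
    (m : V → V → Option (Fin 3)) (u v : V) (t : Fin 3) : ℕ :=
  {w : V | G.Adj u w ∧ w ≠ v ∧ m w u = some t}.ncard

/-- The smallest color minimizing `f`. -/
def argminFin3 (f : Fin 3 → ℕ) : Fin 3 :=
  if f 0 ≤ f 1 ∧ f 0 ≤ f 2 then 0 else if f 1 ≤ f 2 then 1 else 2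

open Classical in
/-- Gallager update (threshold τ = 1): `U(m)(u→v) = none` if at least two distinct colors
have count 0, otherwise the smallest color minimizing the count. -/
noncomputable def gallagerUpdate {V : Type*} (G : SimpleGraph V)
    (m : V → V → Option (Fin 3)) : V → V → Option (Fin 3) := fun u v =>
  if ∃ t₁ t₂ : Fin 3, t₁ ≠ t₂ ∧ msgCount G m u v t₁ = 0 ∧ msgCount G m u v t₂ = 0 then none
  else some (argminFin3 (msgCount G m u v))

/-- The number of neighbors `w` of `u` with `m(w→u) = some t`. -/
noncomputable def outCount {V : Type*} (G : SimpleGraph V)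
    (m : V → V → Option (Fin 3)) (u : V) (t : Fin 3) : ℕ :=
  {w : V | G.Adj u w ∧ m w u = some t}.ncard

open Classical in
/-- Output `B(u, m)` of a message state at a vertex `u`. -/
noncomputable def gallagerOutput {V : Type*} (G : SimpleGraph V)
    (m : V → V → Option (Fin 3)) (u : V) : Option (Fin 3) :=
  if ∃ t₁ t₂ : Fin 3, t₁ ≠ t₂ ∧ outCount G m u t₁ = 0 ∧ outCount G m u t₂ = 0 then none
  else some (argminFin3 (outCount G m u))

/-- The Gallager iterates: `m⁰(u→v) = some (φ u)`, `mⁱ⁺¹ = U(mⁱ)`. -/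
noncomputable def gallagerIter {V : Type*} (G : SimpleGraph V) (φ : V → Fin 3) :
    ℕ → V → V → Option (Fin 3)
  | 0 => fun u _ => some (φ u)
  | i + 1 => gallagerUpdate G (gallagerIter G φ i)


section

open Finset
open scoped Classical

section InfectionClosure

variable {V : Type*} [DecidableEq V]

/-- The unordered pairs of distinct vertices of `S`. -/
def pairsIn (S : Finset V) : Finset (Sym2 V) :=
  S.offDiag.image (Function.uncurry Sym2.mk)

/-- The edges of `G` with both endpoints in `S`. -/
noncomputable def edgesIn (G : SimpleGraph V) (S : Finset V) : Finset (Sym2 V) :=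
  (pairsIn S).filter (· ∈ G.edgeSet)

/-- The neighbors of `v` in `S`. -/
noncomputable def nbrsIn (G : SimpleGraph V) (S : Finset V) (v : V) : Finset V :=
  S.filter (G.Adj v)

theorem mem_edgesIn {G : SimpleGraph V} {S : Finset V} {v w : V} :
    s(v, w) ∈ edgesIn G S ↔ v ∈ S ∧ w ∈ S ∧ G.Adj v w := by
  simp only [edgesIn, pairsIn, mem_filter, mem_image, mem_offDiag, SimpleGraph.mem_edgeSet,
    Prod.exists, Function.uncurry_apply_pair]
  constructor
  · rintro ⟨⟨a, b, ⟨ha, hb, -⟩, h⟩, hadj⟩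
    rcases Sym2.eq_iff.1 h with ⟨rfl, rfl⟩ | ⟨rfl, rfl⟩
    exacts [⟨ha, hb, hadj⟩, ⟨hb, ha, hadj⟩]
  · rintro ⟨hv, hw, h⟩
    exact ⟨⟨v, w, ⟨hv, hw, h.ne⟩, rfl⟩, h⟩

theorem card_edgesIn_insert (G : SimpleGraph V) (S : Finset V) (v : V) (hv : v ∉ S) :
    #(edgesIn G S) + #(nbrsIn G S v) ≤ #(edgesIn G (insert v S)) := by
  have hinj : Set.InjOn (fun w => s(v, w)) (nbrsIn G S v) := by
    intro a _ b _ h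
    exact Sym2.congr_right.1 h
  have hdisj : Disjoint (edgesIn G S) ((nbrsIn G S v).image fun w => s(v, w)) := by
    rw [Finset.disjoint_left]
    intro e he he'
    obtain ⟨w, -, rfl⟩ := mem_image.1 he'
    exact hv (mem_edgesIn.1 he).1
  rw [← card_image_of_injOn hinj, ← card_union_of_disjoint hdisj]
  refine card_le_card (union_subset ?_ ?_)
  · intro e
    induction e with
    | _ a b =>
      simp only [mem_edgesIn]
      rintro ⟨ha, hb, h⟩
      exact ⟨mem_insert_of_mem ha, mem_insert_of_mem hb, h⟩
  · intro e he
    obtain ⟨w, hw, rfl⟩ := mem_image.1 he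
    obtain ⟨hw, h⟩ := mem_filter.1 hw
    exact mem_edgesIn.2 ⟨mem_insert_self _ _, mem_insert_of_mem hw, h⟩

/-- Infect `B` and then, inside `R` and up to `m` vertices in total, vertices with more than `θ`
infected neighbors: every infection contributes more than `θ` edges. -/
theorem exists_infected_set [Fintype V] (G : SimpleGraph V) (θ : ℝ) (B R : Finset V) (m : ℕ)
    (hBR : B ⊆ R) (hBm : #B ≤ m) :
    ∃ X, B ⊆ X ∧ X ⊆ R ∧ #X ≤ m ∧ θ * #(X \ B) ≤ #(edgesIn G X) ∧
      (#X = m ∨ ∀ v ∈ R, v ∉ X → (#(nbrsIn G X v) : ℝ) ≤ θ) := by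
  let F : Finset (Finset V) := univ.filter fun X =>
    B ⊆ X ∧ X ⊆ R ∧ #X ≤ m ∧ θ * #(X \ B) ≤ #(edgesIn G X)
  have hF : F.Nonempty := ⟨B, by simp [F, hBR, hBm]⟩
  obtain ⟨X, hX, hmax⟩ := exists_max_image F card hF
  obtain ⟨hBX, hXR, hXm, hXe⟩ := (mem_filter.1 hX).2
  refine ⟨X, hBX, hXR, hXm, hXe, ?_⟩
  by_contra! h
  obtain ⟨hne, v, hvR, hvX, hv⟩ := h
  have hins : insert v X ∈ F := by
    refine mem_filter.2 ⟨mem_univ _, hBX.trans (subset_insert _ _),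
      insert_subset hvR hXR, ?_, ?_⟩
    · rw [card_insert_of_notMem hvX]
      omega
    · have h1 := card_edgesIn_insert G X v hvX
      have h2 : #(insert v X \ B) = #(X \ B) + 1 := by
        rw [insert_sdiff_of_notMem _ (fun hb => hvX (hBX hb)), card_insert_of_notMem]
        exact fun hm => hvX (mem_sdiff.1 hm).1
      have h3 : (#(edgesIn G X) : ℝ) + #(nbrsIn G X v) ≤ #(edgesIn G (insert v X)) := by
        exact_mod_cast h1
      rw [h2]
      push_cast
      linarith
  have := hmax _ hins
  rw [card_insert_of_notMem hvX] at this
  omega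

theorem card_lt_two_mul_card_inter {G : SimpleGraph V} {θ : ℝ} (hθ : 0 < θ) {B X : Finset V}
    (hX : θ * #(X \ B) ≤ #(edgesIn G X)) (hsparse : (#(edgesIn G X) : ℝ) < θ / 2 * #X) :
    #X < 2 * #(X ∩ B) := by
  have h1 : (#(X \ B) : ℝ) + #(X ∩ B) = #X := by
    exact_mod_cast card_sdiff_add_card_inter X B
  have h2 : (#(X \ B) : ℝ) < #X / 2 := by
    by_contra! h
    nlinarith
  have h3 : (#X : ℝ) < 2 * #(X ∩ B) := by linarith
  exact_mod_cast h3

/-- In a locally sparse graph a small set `B` has a small closure `W` under infection by more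
than `θ` neighbors, and at least half of each component of `G[W]` consists of elements of `B`. -/
theorem exists_infection_closure [Fintype V] (G : SimpleGraph V) {θ : ℝ} (hθ : 0 < θ)
    (B : Finset V) (m : ℕ)
    (hsparse : ∀ S : Finset V, S.Nonempty → #S ≤ m → (#(edgesIn G S) : ℝ) < θ / 2 * #S)
    (hBm : 2 * #B < m) :
    ∃ W, B ⊆ W ∧ #W ≤ 2 * #B ∧ (∀ v, v ∉ W → (#(nbrsIn G W v) : ℝ) ≤ θ) ∧
      ∀ S ⊆ W, S.Nonempty → (∀ v ∈ S, ∀ w ∈ W, G.Adj v w → w ∈ S) → #S ≤ 2 * #(S ∩ B) := by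
  let F : Finset (Finset V) := univ.filter fun W =>
    B ⊆ W ∧ ∀ v, v ∉ W → (#(nbrsIn G W v) : ℝ) ≤ θ
  obtain ⟨X, hBX, -, hXm, hXe, hX⟩ :=
    exists_infected_set G θ B univ m (subset_univ B) (by omega)
  have hX2 : #X ≤ 2 * #B := by
    rcases X.eq_empty_or_nonempty with rfl | hne
    · simp
    · have := card_lt_two_mul_card_inter hθ hXe (hsparse X hne hXm)
      have := card_le_card (inter_subset_right : X ∩ B ⊆ B)
      omega
  have hXF : X ∈ F := by
    refine mem_filter.2 ⟨mem_univ _, hBX, fun v hv => ?_⟩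
    exact (hX.resolve_left (by omega)) v (mem_univ v) hv
  obtain ⟨W, hW, hmin⟩ := exists_min_image F card ⟨X, hXF⟩
  obtain ⟨hBW, hcl⟩ := (mem_filter.1 hW).2
  have hW2 : #W ≤ 2 * #B := (hmin X hXF).trans hX2
  refine ⟨W, hBW, hW2, hcl, fun S hSW hS hiso => ?_⟩
  obtain ⟨Y, hBY, hYS, -, hYe, hY⟩ :=
    exists_infected_set G θ (S ∩ B) S #S inter_subset_left (card_le_card inter_subset_left)
  have hYS' : Y = S := by
    rcases hY with hY | hY
    · exact eq_of_subset_of_card_le hYS hY.ge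
    · by_contra hne
      have hmem : W \ S ∪ Y ∈ F := by
        refine mem_filter.2 ⟨mem_univ _, fun v hv => ?_, fun v hv => ?_⟩
        · by_cases hvS : v ∈ S
          · exact mem_union_right _ (hBY (mem_inter.2 ⟨hvS, hv⟩))
          · exact mem_union_left _ (mem_sdiff.2 ⟨hBW hv, hvS⟩)
        · rw [mem_union, mem_sdiff] at hv
          push Not at hv
          by_cases hvW : v ∈ W
          · refine le_trans ?_ (hY v (hv.1 hvW) hv.2)
            exact_mod_cast card_le_card fun w hw => by
              obtain ⟨hw, hadj⟩ := mem_filter.1 hw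
              refine mem_filter.2 ⟨?_, hadj⟩
              rcases mem_union.1 hw with hw | hw
              · obtain ⟨hwW, hwS⟩ := mem_sdiff.1 hw
                exact absurd (hiso v (hv.1 hvW) w hwW hadj) hwS
              · exact hw
          · refine le_trans ?_ (hcl v hvW)
            exact_mod_cast card_le_card (filter_subset_filter _
              (union_subset sdiff_subset (hYS.trans hSW)))
      have h1 := hmin _ hmem
      have h2 : W \ S ∪ Y ⊂ W := by
        refine ⟨union_subset sdiff_subset (hYS.trans hSW), fun h => hne ?_⟩
        refine hYS.antisymm fun v hv => ?_
        rcases mem_union.1 (h (hSW hv)) with h' | h'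
        · exact absurd hv (mem_sdiff.1 h').2
        · exact h'
      have := card_lt_card h2
      omega
  subst hYS'
  have hle := (card_le_card hSW).trans (hW2.trans hBm.le)
  rw [sdiff_inter_self_left] at hYe
  exact (card_lt_two_mul_card_inter hθ hYe (hsparse Y hS hle)).le

/-- A component of an induced subgraph is connected through edges of the ambient graph. -/
theorem card_supp_le_card_edgesIn [Fintype V] (G : SimpleGraph V) (W : Set V)
    (comp : (G.induce W).ConnectedComponent) :
    ∃ S : Finset V, S.Nonempty ∧ (S : Set V) ⊆ W ∧ #S = comp.supp.ncard ∧
      #S ≤ #(edgesIn G S) + 1 ∧ ∀ v ∈ S, ∀ w ∈ W, G.Adj v w → w ∈ S := by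
  let S : Finset V := comp.supp.toFinset.image Subtype.val
  have hS : ∀ v, v ∈ S ↔ ∃ h : v ∈ W, (⟨v, h⟩ : W) ∈ comp.supp := by
    intro v
    simp only [S, mem_image, Set.mem_toFinset, Subtype.exists, exists_and_right, exists_eq_right]
  have hcard : #S = comp.supp.ncard := by
    rw [card_image_of_injective _ Subtype.val_injective, Set.ncard_eq_toFinset_card']
  refine ⟨S, ?_, fun v hv => ((hS v).1 hv).1, hcard, ?_, ?_⟩
  · obtain ⟨x, hx⟩ := comp.nonempty_supp
    exact ⟨x, (hS x).2 ⟨x.2, hx⟩⟩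
  · have h := comp.connected_toSimpleGraph.card_vert_le_card_edgeSet_add_one
    have h1 : Nat.card comp = #S := by rw [hcard]; rfl
    have h2 : Nat.card comp.toSimpleGraph.edgeSet ≤ #(edgesIn G S) := by
      rw [← Nat.card_eq_finsetCard]
      have hinj : Function.Injective fun x : comp => (x.1.1 : V) :=
        Subtype.val_injective.comp Subtype.val_injective
      have hmap : ∀ e ∈ comp.toSimpleGraph.edgeSet,
          Sym2.map (fun x : comp => (x.1.1 : V)) e ∈ edgesIn G S := by
        intro e
        induction e with
        | _ a b =>
          intro he
          rw [Sym2.map_mk, mem_edgesIn]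
          exact ⟨(hS _).2 ⟨a.1.2, a.2⟩, (hS _).2 ⟨b.1.2, b.2⟩, he⟩
      refine Nat.card_le_card_of_injective
        (fun e : comp.toSimpleGraph.edgeSet => ⟨_, hmap e.1 e.2⟩) fun e e' hee => ?_
      exact Subtype.ext (Sym2.map.injective hinj (congrArg Subtype.val hee))
    omega
  · intro v hv w hw hadj
    obtain ⟨hvW, hv⟩ := (hS v).1 hv
    refine (hS w).2 ⟨hw, ?_⟩
    have h : (G.induce W).Adj ⟨v, hvW⟩ ⟨w, hw⟩ := hadj
    exact (comp.mem_supp_congr_adj h).1 hv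

end InfectionClosure

section PlantedModel

theorem isProbabilityMeasure_bernoulliMeasure {p : ℝ} (hp0 : 0 ≤ p) (hp1 : p ≤ 1) :
    IsProbabilityMeasure (bernoulliMeasure p) := by
  constructor
  simp only [bernoulliMeasure, Measure.add_apply, Measure.smul_apply, measure_univ, smul_eq_mul,
    mul_one]
  rw [← ENNReal.ofReal_add hp0 (by linarith)]
  simp

theorem isProbabilityMeasure_plantedMeasure (n : ℕ) {p : ℝ} (hp0 : 0 ≤ p) (hp1 : p ≤ 1) :
    IsProbabilityMeasure (plantedMeasure n p) := by
  have := isProbabilityMeasure_bernoulliMeasure hp0 hp1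
  unfold plantedMeasure
  infer_instance

theorem integral_bernoulliMeasure {p : ℝ} (hp0 : 0 ≤ p) (hp1 : p ≤ 1) (f : Bool → ℝ) :
    ∫ b, f b ∂bernoulliMeasure p = p * f true + (1 - p) * f false := by
  have h1 : Integrable f (ENNReal.ofReal p • Measure.dirac true) :=
    Integrable.of_finite.smul_measure ENNReal.ofReal_ne_top
  have h2 : Integrable f (ENNReal.ofReal (1 - p) • Measure.dirac false) :=
    Integrable.of_finite.smul_measure ENNReal.ofReal_ne_top
  rw [bernoulliMeasure, integral_add_measure h1 h2, integral_smul_measure, integral_smul_measure,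
    integral_dirac, integral_dirac, ENNReal.toReal_ofReal hp0,
    ENNReal.toReal_ofReal (by linarith), smul_eq_mul, smul_eq_mul]

/-- Exponential Markov bound for a product of Bernoulli measures: all coordinates in `F` are
`true` while at most `x` coordinates in the disjoint set `A` are. -/
theorem measureReal_pi_bernoulli_le {ι : Type*} [Fintype ι] {p t x : ℝ}
    (hp0 : 0 ≤ p) (hp1 : p ≤ 1) (ht : 0 ≤ t) (F A : Finset ι) (hFA : Disjoint F A) :
    (Measure.pi fun _ : ι => bernoulliMeasure p).real
        {ω | (∀ e ∈ F, ω e = true) ∧ (#{e ∈ A | ω e = true} : ℝ) ≤ x} ≤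
      p ^ #F * Real.exp (t * x - #A * p * (1 - Real.exp (-t))) := by
  have := isProbabilityMeasure_bernoulliMeasure hp0 hp1
  set μ := Measure.pi fun _ : ι => bernoulliMeasure p
  let f : ι → Bool → ℝ := fun e b =>
    if e ∈ F then (if b then 1 else 0) else if e ∈ A then (if b then Real.exp (-t) else 1) else 1
  have hf0 : ∀ e b, 0 ≤ f e b := by
    intro e b
    simp only [f]
    split_ifs <;> positivity
  set E := {ω : ι → Bool | (∀ e ∈ F, ω e = true) ∧ (#{e ∈ A | ω e = true} : ℝ) ≤ x}
  have hE : MeasurableSet E := E.toFinite.measurableSet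
  have hprod : ∀ ω ∈ E, Real.exp (-(t * x)) ≤ ∏ e, f e (ω e) := by
    rintro ω ⟨hF, hA⟩
    have h1 : ∀ e, f e (ω e) = if e ∈ A ∧ ω e = true then Real.exp (-t) else 1 := by
      intro e
      by_cases heF : e ∈ F
      · simp [f, heF, hF e heF, Finset.disjoint_left.1 hFA heF]
      · by_cases heA : e ∈ A <;> simp [f, heF, heA]
    simp_rw [h1]
    rw [← Finset.prod_filter, prod_const, ← Real.exp_nat_mul]
    have h2 : (univ.filter fun e => e ∈ A ∧ ω e = true) = {e ∈ A | ω e = true} := by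
      ext
      simp
    rw [h2, Real.exp_le_exp]
    nlinarith
  have hint : ∫ ω, ∏ e, f e (ω e) ∂μ = ∏ e, (p * f e true + (1 - p) * f e false) := by
    rw [integral_fintype_prod_eq_prod]
    simp_rw [integral_bernoulliMeasure hp0 hp1]
  have hfac : ∏ e, (p * f e true + (1 - p) * f e false) ≤
      p ^ #F * Real.exp (-(#A * p * (1 - Real.exp (-t)))) := by
    have h1 : ∀ e, p * f e true + (1 - p) * f e false ≤
        (if e ∈ F then p else 1) * (if e ∈ A then Real.exp (-(p * (1 - Real.exp (-t)))) else 1) := by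
      intro e
      by_cases heF : e ∈ F
      · simp [f, heF, Finset.disjoint_left.1 hFA heF]
      · by_cases heA : e ∈ A
        · have := Real.one_sub_le_exp_neg (p * (1 - Real.exp (-t)))
          simp only [f, heF, heA, if_false, if_true, Bool.false_eq_true]
          linarith
        · simp [f, heF, heA]
    refine (prod_le_prod (fun e _ => ?_) fun e _ => h1 e).trans ?_
    · exact add_nonneg (mul_nonneg hp0 (hf0 _ _)) (mul_nonneg (by linarith) (hf0 _ _))
    · rw [prod_mul_distrib, prod_ite_mem, prod_ite_mem, univ_inter, univ_inter, prod_const,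
        prod_const, ← Real.exp_nat_mul]
      apply le_of_eq
      ring_nf
  have hmarkov : Real.exp (-(t * x)) * μ.real E ≤ ∫ ω, ∏ e, f e (ω e) ∂μ := by
    have h1 : Real.exp (-(t * x)) * μ.real E =
        ∫ ω, E.indicator (fun _ => Real.exp (-(t * x))) ω ∂μ := by
      rw [integral_indicator_const _ hE, smul_eq_mul, mul_comm]
    rw [h1]
    refine integral_mono Integrable.of_finite Integrable.of_finite fun ω => ?_
    by_cases hω : ω ∈ E
    · simpa [hω] using hprod ω hω
    · simpa [hω] using prod_nonneg fun e _ => hf0 e (ω e)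
  have h3 := hmarkov.trans (hint.le.trans hfac)
  have h4 : μ.real E = Real.exp (t * x) * (Real.exp (-(t * x)) * μ.real E) := by
    rw [← mul_assoc, ← Real.exp_add]
    simp
  rw [h4, sub_eq_add_neg, Real.exp_add]
  calc _ ≤ Real.exp (t * x) * (p ^ #F * Real.exp (-(#A * p * (1 - Real.exp (-t))))) := by gcongr
    _ = _ := by ring

theorem mem_edgeSet_plantedGraph {n : ℕ} {ω : BichromPair n → Bool} {e : Sym2 (Fin n)} :
    e ∈ (plantedGraph n ω).edgeSet ↔ ∃ h : Bichrom n e, ω ⟨e, h⟩ = true := by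
  induction e with
  | _ v w =>
    simp only [plantedGraph, SimpleGraph.mem_edgeSet, SimpleGraph.fromEdgeSet_adj,
      Set.mem_ofPred_eq, and_iff_left_iff_imp]
    rintro ⟨h, -⟩ rfl
    exact h rfl

/-- The previous bound in terms of the edges of the planted graph. -/
theorem measureReal_plantedMeasure_edges_le {n : ℕ} {p t x : ℝ} (hp0 : 0 ≤ p) (hp1 : p ≤ 1)
    (ht : 0 ≤ t) (F A : Finset (Sym2 (Fin n))) (hFA : Disjoint F A) (hA : ∀ e ∈ A, Bichrom n e) :
    (plantedMeasure n p).real {ω | (∀ e ∈ F, e ∈ (plantedGraph n ω).edgeSet) ∧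
        (#{e ∈ A | e ∈ (plantedGraph n ω).edgeSet} : ℝ) ≤ x} ≤
      p ^ #F * Real.exp (t * x - #A * p * (1 - Real.exp (-t))) := by
  have := isProbabilityMeasure_plantedMeasure n hp0 hp1
  by_cases hF : ∀ e ∈ F, Bichrom n e
  · have hdisj : Disjoint (F.subtype (Bichrom n)) (A.subtype (Bichrom n)) := by
      rw [Finset.disjoint_left]
      intro e he he'
      exact Finset.disjoint_left.1 hFA (mem_subtype.1 he) (mem_subtype.1 he')
    have h := measureReal_pi_bernoulli_le (x := x) hp0 hp1 ht _ _ hdisj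
    rw [card_subtype, card_subtype, filter_true_of_mem hF, filter_true_of_mem hA] at h
    refine (measureReal_mono ?_).trans h
    rintro ω ⟨h1, h2⟩
    refine ⟨fun e he => ?_, le_trans ?_ h2⟩
    · obtain ⟨_, h⟩ := mem_edgeSet_plantedGraph.1 (h1 e.1 (mem_subtype.1 he))
      exact h
    · norm_cast
      refine card_le_card_of_injOn Subtype.val (fun e he => ?_) Subtype.val_injective.injOn
      obtain ⟨heA, he⟩ := mem_filter.1 he
      exact mem_filter.2 ⟨mem_subtype.1 heA, mem_edgeSet_plantedGraph.2 ⟨e.2, he⟩⟩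
  · push Not at hF
    obtain ⟨e, heF, he⟩ := hF
    have : {ω | (∀ e ∈ F, e ∈ (plantedGraph n ω).edgeSet) ∧
        (#{e ∈ A | e ∈ (plantedGraph n ω).edgeSet} : ℝ) ≤ x} = ∅ := by
      rw [Set.eq_empty_iff_forall_notMem]
      rintro ω ⟨h, -⟩
      exact he (mem_edgeSet_plantedGraph.1 (h e heF)).1
    rw [this, measureReal_empty]
    positivity

/-- The vertices with fewer than `d / 4` neighbors in some other color class. -/
noncomputable def deficientVerts (n : ℕ) (G : SimpleGraph (Fin n)) (d : ℝ) : Finset (Fin n) :=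
  univ.filter fun v => ∃ i, i ≠ plantedColoring n v ∧
    (#{w | G.Adj v w ∧ plantedColoring n w = i} : ℝ) < d / 4

theorem card_colorClass (n : ℕ) (hn : 3 ∣ n) (i : Fin 3) :
    n / 3 ≤ #{w | plantedColoring n w = i} := by
  obtain ⟨k, rfl⟩ := hn
  rw [Nat.mul_div_cancel_left _ (by norm_num)]
  have h := card_le_card_of_injOn (s := (univ : Finset (Fin k)))
    (t := univ.filter fun w => plantedColoring (3 * k) w = i)
    (fun j => ⟨3 * j.1 + i.1, by omega⟩) (fun j _ => ?_) (fun a _ b _ hab => ?_)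
  · simpa using h
  · simp only [coe_filter, mem_univ, true_and, Set.mem_ofPred_eq, plantedColoring, Fin.ext_iff]
    omega
  · simp only [Fin.mk.injEq] at hab
    omega

/-- For `d = n p`, prescribed edges inside a small set `S` are present and all vertices of a
prescribed `U ⊆ S` are deficient with probability at most `p ^ #F * (2 exp (-d / 200)) ^ #U`. -/
theorem measureReal_edges_deficient_le {n : ℕ} (hn : 3 ∣ n) {p : ℝ} (hp0 : 0 ≤ p) (hp1 : p ≤ 1)
    (S U : Finset (Fin n)) (hUS : U ⊆ S) (hS : (#S : ℝ) ≤ n / 1000000)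
    (F : Finset (Sym2 (Fin n))) (hF : F ⊆ pairsIn S) :
    (plantedMeasure n p).real {ω | (∀ e ∈ F, e ∈ (plantedGraph n ω).edgeSet) ∧
        U ⊆ deficientVerts n (plantedGraph n ω) (n * p)} ≤
      p ^ #F * (2 * Real.exp (-(n * p) / 200)) ^ #U := by
  have := isProbabilityMeasure_plantedMeasure n hp0 hp1
  let col : Finset (Fin n) → Fin n → Fin 3 := fun T v =>
    plantedColoring n v + if v ∈ T then 1 else 2
  have hcol : ∀ T v, plantedColoring n v ≠ col T v := by
    intro T v
    simp only [col]
    generalize plantedColoring n v = a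
    split_ifs <;> revert a <;> decide
  let P : Finset (Fin n) → Finset (Σ _ : Fin n, Fin n) := fun T =>
    U.sigma fun v => univ.filter fun w => w ∉ S ∧ plantedColoring n w = col T v
  let A : Finset (Fin n) → Finset (Sym2 (Fin n)) := fun T => (P T).image fun x => s(x.1, x.2)
  have hP : ∀ T x, x ∈ P T ↔ x.1 ∈ U ∧ x.2 ∉ S ∧ plantedColoring n x.2 = col T x.1 := by
    intro T x
    simp [P]
  have hAcard : ∀ T, (#U : ℝ) * (n / 3 - n / 1000000) ≤ #(A T) := by
    intro T
    have h1 : #(A T) = #(P T) := by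
      refine card_image_of_injOn ?_
      rintro ⟨a, b⟩ hab ⟨a', b'⟩ hab' h
      obtain ⟨ha, hb, -⟩ := (hP T _).1 hab
      obtain ⟨ha', hb', -⟩ := (hP T _).1 hab'
      rcases Sym2.eq_iff.1 h with ⟨h1, h2⟩ | ⟨h1, h2⟩ <;> dsimp only at *
      · rw [h1, h2]
      · exact absurd (h1 ▸ hUS ha) hb'
    rw [h1, card_sigma]
    push_cast
    rw [← nsmul_eq_mul]
    refine card_nsmul_le_sum _ _ _ fun v _ => ?_
    have h2 : univ.filter (fun w => plantedColoring n w = col T v) ⊆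
        univ.filter (fun w => w ∉ S ∧ plantedColoring n w = col T v) ∪ S := by
      intro w hw
      by_cases hwS : w ∈ S
      · exact mem_union_right _ hwS
      · exact mem_union_left _ (mem_filter.2 ⟨mem_univ _, hwS, (mem_filter.1 hw).2⟩)
    have h3 := (card_colorClass n hn (col T v)).trans ((card_le_card h2).trans (card_union_le _ _))
    have h4 : ((n / 3 : ℕ) : ℝ) = n / 3 := Nat.cast_div hn (by norm_num)
    have h5 : ((n / 3 : ℕ) : ℝ) ≤
        #(univ.filter (fun w => w ∉ S ∧ plantedColoring n w = col T v)) + #S := by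
      exact_mod_cast h3
    linarith
  have hbound : ∀ T, (plantedMeasure n p).real {ω | (∀ e ∈ F, e ∈ (plantedGraph n ω).edgeSet) ∧
      (#{e ∈ A T | e ∈ (plantedGraph n ω).edgeSet} : ℝ) ≤ #U * (n * p / 4)} ≤
      p ^ #F * Real.exp (-(n * p) / 200) ^ #U := by
    intro T
    refine (measureReal_plantedMeasure_edges_le (t := 1 / 10) hp0 hp1 (by norm_num) F (A T)
      ?_ ?_).trans ?_
    · rw [Finset.disjoint_left]
      intro e he he'
      obtain ⟨x, hx, rfl⟩ := mem_image.1 he'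
      obtain ⟨⟨a, b⟩, hab, h⟩ := mem_image.1 (hF he)
      obtain ⟨ha, hb, -⟩ := mem_offDiag.1 hab
      rcases Sym2.eq_iff.1 h with ⟨-, h2⟩ | ⟨h1, -⟩
      · exact ((hP T x).1 hx).2.1 (h2 ▸ hb)
      · exact ((hP T x).1 hx).2.1 (h1 ▸ ha)
    · intro e he
      obtain ⟨x, hx, rfl⟩ := mem_image.1 he
      have := ((hP T x).1 hx).2.2
      exact fun h => hcol T x.1 (h.trans this)
    · rw [← Real.exp_nat_mul]
      have hexp : Real.exp (-(1 / 10)) ≤ 1 - 0.095 := by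
        have := Real.quadratic_le_exp_of_nonneg (x := 1 / 10) (by norm_num)
        rw [Real.exp_neg, inv_le_comm₀ (Real.exp_pos _) (by norm_num)]
        refine le_trans ?_ this
        norm_num
      gcongr
      have h1 : (#U : ℝ) * (n / 3 - n / 1000000) * p * 0.095 ≤
          #(A T) * p * (1 - Real.exp (-(1 / 10))) := by
        gcongr
        · exact hAcard T
        · linarith
      have h2 : 0 ≤ (#U : ℝ) * (n * p) := by positivity
      nlinarith
  have hsub : {ω | (∀ e ∈ F, e ∈ (plantedGraph n ω).edgeSet) ∧
        U ⊆ deficientVerts n (plantedGraph n ω) (n * p)} ⊆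
      ⋃ T ∈ U.powerset, {ω | (∀ e ∈ F, e ∈ (plantedGraph n ω).edgeSet) ∧
        (#{e ∈ A T | e ∈ (plantedGraph n ω).edgeSet} : ℝ) ≤ #U * (n * p / 4)} := by
    rintro ω ⟨hωF, hU⟩
    set G := plantedGraph n ω
    let T := U.filter fun v =>
      (#{w | G.Adj v w ∧ plantedColoring n w = plantedColoring n v + 1} : ℝ) < n * p / 4
    simp only [Set.mem_iUnion, Set.mem_ofPred_eq, exists_prop, mem_powerset]
    refine ⟨T, filter_subset _ _, hωF, ?_⟩
    have hdeg : ∀ v ∈ U,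
        (#{w | G.Adj v w ∧ plantedColoring n w = col T v} : ℝ) ≤ n * p / 4 := by
      intro v hv
      by_cases hvT : v ∈ T
      · simp only [col, hvT, if_true]
        exact (mem_filter.1 hvT).2.le
      · simp only [col, hvT, if_false]
        obtain ⟨i, hi, hlt⟩ := (mem_filter.1 (hU hv)).2
        have h12 : i = plantedColoring n v + 1 ∨ i = plantedColoring n v + 2 := by
          clear hlt
          revert hi
          generalize plantedColoring n v = a
          revert a i
          decide
        rcases h12 with rfl | rfl
        · exact absurd (mem_filter.2 ⟨hv, hlt⟩) hvT
        · exact hlt.le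
    have hcount : #{e ∈ A T | e ∈ G.edgeSet} ≤
        ∑ v ∈ U, #{w | G.Adj v w ∧ plantedColoring n w = col T v} := by
      rw [filter_image, ← card_sigma]
      refine card_image_le.trans (card_le_card fun x hx => ?_)
      obtain ⟨hx, hadj⟩ := mem_filter.1 hx
      obtain ⟨h1, -, h2⟩ := (hP T x).1 hx
      exact mem_sigma.2 ⟨h1, mem_filter.2 ⟨mem_univ _, hadj, h2⟩⟩
    calc (#{e ∈ A T | e ∈ G.edgeSet} : ℝ) ≤
        ∑ v ∈ U, (#{w | G.Adj v w ∧ plantedColoring n w = col T v} : ℝ) := by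
          exact_mod_cast hcount
      _ ≤ ∑ v ∈ U, (n * p / 4 : ℝ) := sum_le_sum hdeg
      _ = _ := by rw [sum_const, nsmul_eq_mul]
  refine (measureReal_mono hsub (measure_ne_top _ _)).trans
    ((measureReal_biUnion_finset_le _ _).trans ?_)
  refine (sum_le_sum fun T _ => hbound T).trans ?_
  rw [sum_const, card_powerset, nsmul_eq_mul, mul_pow]
  push_cast
  exact le_of_eq (by ring)

/-- Union bound over `S`, `U ⊆ S` and sets of `r` pairs inside `S`. -/
theorem measureReal_exists_edges_deficient_le {n : ℕ} (hn : 3 ∣ n) {p : ℝ} (hp0 : 0 ≤ p)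
    (hp1 : p ≤ 1) (s r u : ℕ) (hs : (s : ℝ) ≤ n / 1000000) :
    (plantedMeasure n p).real {ω | ∃ S : Finset (Fin n), #S = s ∧
        r ≤ #(edgesIn (plantedGraph n ω) S) ∧
        u ≤ #(S ∩ deficientVerts n (plantedGraph n ω) (n * p))} ≤
      n.choose s * 2 ^ s * (s.choose 2).choose r * p ^ r *
        (2 * Real.exp (-(n * p) / 200)) ^ u := by
  have := isProbabilityMeasure_plantedMeasure n hp0 hp1
  set q := 2 * Real.exp (-(n * p) / 200) with hq
  have hpairs : ∀ S : Finset (Fin n), #(pairsIn S) = (#S).choose 2 := Sym2.card_image_offDiag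
  have hsub : {ω | ∃ S : Finset (Fin n), #S = s ∧ r ≤ #(edgesIn (plantedGraph n ω) S) ∧
        u ≤ #(S ∩ deficientVerts n (plantedGraph n ω) (n * p))} ⊆
      ⋃ S ∈ powersetCard s univ, ⋃ U ∈ powersetCard u S, ⋃ F ∈ powersetCard r (pairsIn S),
        {ω | (∀ e ∈ F, e ∈ (plantedGraph n ω).edgeSet) ∧
          U ⊆ deficientVerts n (plantedGraph n ω) (n * p)} := by
    rintro ω ⟨S, hS, hr, hu⟩
    obtain ⟨F, hF, hFr⟩ := exists_subset_card_eq hr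
    obtain ⟨U, hU, hUu⟩ := exists_subset_card_eq hu
    simp only [Set.mem_iUnion, Set.mem_ofPred_eq, exists_prop, mem_powersetCard]
    exact ⟨S, ⟨subset_univ _, hS⟩, U, ⟨hU.trans inter_subset_left, hUu⟩, F,
      ⟨hF.trans (filter_subset _ _), hFr⟩, fun e he => (mem_filter.1 (hF he)).2,
      hU.trans inter_subset_right⟩
  refine (measureReal_mono hsub (measure_ne_top _ _)).trans ?_
  have hS : ∀ S ∈ powersetCard s (univ : Finset (Fin n)),
      (plantedMeasure n p).real (⋃ U ∈ powersetCard u S, ⋃ F ∈ powersetCard r (pairsIn S),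
        {ω | (∀ e ∈ F, e ∈ (plantedGraph n ω).edgeSet) ∧
          U ⊆ deficientVerts n (plantedGraph n ω) (n * p)}) ≤
      2 ^ s * ((s.choose 2).choose r * (p ^ r * q ^ u)) := by
    intro S hS
    have hSs := (mem_powersetCard.1 hS).2
    have hU : ∀ U ∈ powersetCard u S,
        (plantedMeasure n p).real (⋃ F ∈ powersetCard r (pairsIn S),
          {ω | (∀ e ∈ F, e ∈ (plantedGraph n ω).edgeSet) ∧
            U ⊆ deficientVerts n (plantedGraph n ω) (n * p)}) ≤
        (s.choose 2).choose r * (p ^ r * q ^ u) := by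
      intro U hU
      obtain ⟨hUS, hUu⟩ := mem_powersetCard.1 hU
      have hF : ∀ F ∈ powersetCard r (pairsIn S), (plantedMeasure n p).real
          {ω | (∀ e ∈ F, e ∈ (plantedGraph n ω).edgeSet) ∧
            U ⊆ deficientVerts n (plantedGraph n ω) (n * p)} ≤ p ^ r * q ^ u := by
        intro F hF
        obtain ⟨hFS, hFr⟩ := mem_powersetCard.1 hF
        rw [← hFr, ← hUu]
        exact measureReal_edges_deficient_le hn hp0 hp1 S U hUS (by rwa [hSs]) F hFS
      refine (measureReal_biUnion_finset_le _ _).trans ((sum_le_card_nsmul _ _ _ hF).trans ?_)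
      rw [card_powersetCard, hpairs, hSs, nsmul_eq_mul]
    refine (measureReal_biUnion_finset_le _ _).trans ((sum_le_card_nsmul _ _ _ hU).trans ?_)
    rw [card_powersetCard, hSs, nsmul_eq_mul]
    have : (s.choose u : ℝ) ≤ 2 ^ s := by exact_mod_cast Nat.choose_le_two_pow s u
    gcongr
  refine (measureReal_biUnion_finset_le _ _).trans ((sum_le_card_nsmul _ _ _ hS).trans ?_)
  rw [card_powersetCard, card_univ, Fintype.card_fin, nsmul_eq_mul]
  exact le_of_eq (by ring)

theorem choose_le_exp_mul_div_pow (M r : ℕ) (hr : 0 < r) :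
    (M.choose r : ℝ) ≤ (Real.exp 1 * M / r) ^ r := by
  have hr' : (0 : ℝ) < r := by exact_mod_cast hr
  have h1 := Real.pow_div_factorial_le_exp (r : ℝ) hr'.le r
  have h2 : (M.choose r : ℝ) ≤ M ^ r / r.factorial := Nat.choose_le_pow_div r M
  have hf : (0 : ℝ) < r.factorial := by exact_mod_cast r.factorial_pos
  have h3 : Real.exp r = Real.exp 1 ^ r := by rw [← Real.exp_nat_mul, mul_one]
  rw [h3, div_le_iff₀ hf] at h1
  refine h2.trans ?_
  rw [div_pow, mul_pow, div_le_div_iff₀ hf (by positivity)]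
  calc (M : ℝ) ^ r * r ^ r ≤ M ^ r * (Real.exp 1 ^ r * r.factorial) := by gcongr
    _ = _ := by ring

/-- A fixed-size instance of local sparsity. -/
theorem measureReal_exists_dense_le {n : ℕ} (hn : 3 ∣ n) {p : ℝ} (hp0 : 0 ≤ p) (hp1 : p ≤ 1)
    (hd : 120 ≤ n * p) (s : ℕ) (hs0 : 0 < s) (hs : (s : ℝ) ≤ n / 2000000) :
    (plantedMeasure n p).real {ω | ∃ S : Finset (Fin n), #S = s ∧
        n * p / 40 * s ≤ (#(edgesIn (plantedGraph n ω) S) : ℝ)} ≤ s * (1 / 2) ^ s / n := by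
  have := isProbabilityMeasure_plantedMeasure n hp0 hp1
  have hs0' : (1 : ℝ) ≤ s := by exact_mod_cast hs0
  have hn0 : (0 : ℝ) < n := by linarith
  set r := ⌈n * p / 40 * s⌉₊
  have hr : n * p / 40 * s ≤ r := Nat.le_ceil _
  have hr3 : 3 * s ≤ r := by
    have : (3 * s : ℝ) ≤ r := le_trans (by nlinarith) hr
    exact_mod_cast this
  have hr0 : (0 : ℝ) < r := by
    have : (0 : ℝ) < n * p / 40 * s := by positivity
    linarith
  refine (measureReal_mono ?_ (measure_ne_top _ _)).trans
    ((measureReal_exists_edges_deficient_le hn hp0 hp1 s r 0 (by linarith)).trans ?_)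
  · rintro ω ⟨S, hS, h⟩
    exact ⟨S, hS, Nat.ceil_le.2 h, Nat.zero_le _⟩
  have he := Real.exp_one_lt_d9
  have he0 := Real.exp_pos 1
  set e := Real.exp 1
  set y := 20 * e * (s / n) with hy
  have hsn : (s / n : ℝ) ≤ 1 / 2000000 := by
    rw [div_le_iff₀ hn0]
    linarith
  have hsn0 : (0 : ℝ) < s / n := by positivity
  have hy1 : y ≤ 1 := by
    rw [hy]
    nlinarith
  have h1 : ((s.choose 2).choose r : ℝ) * p ^ r ≤ y ^ (3 * s) := by
    refine le_trans ?_ (pow_le_pow_of_le_one (by positivity) hy1 hr3)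
    have h2 : ((s.choose 2 : ℕ) : ℝ) ≤ s ^ 2 / 2 := by
      have := Nat.choose_le_pow_div (α := ℝ) 2 s
      simpa using this
    calc ((s.choose 2).choose r : ℝ) * p ^ r
        ≤ (e * (s.choose 2 : ℕ) / r) ^ r * p ^ r := by
          gcongr
          exact choose_le_exp_mul_div_pow _ _ (by omega)
      _ = (e * (s.choose 2 : ℕ) / r * p) ^ r := by rw [mul_pow]
      _ ≤ y ^ r := by
          gcongr
          rw [hy, div_mul_eq_mul_div, div_le_iff₀ hr0]
          calc e * (s.choose 2 : ℕ) * p ≤ e * (s ^ 2 / 2) * p := by gcongr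
            _ = 20 * e * (s / n) * (n * p / 40 * s) := by
                field_simp
                ring
            _ ≤ _ := by gcongr
  have h3 := choose_le_exp_mul_div_pow n s hs0
  have he4 : e ^ 4 ≤ 55 := by
    calc e ^ 4 ≤ 2.7182818286 ^ 4 := by gcongr
      _ ≤ 55 := by norm_num
  calc (n.choose s : ℝ) * 2 ^ s * (s.choose 2).choose r * p ^ r * _ ^ 0
      = n.choose s * 2 ^ s * ((s.choose 2).choose r * p ^ r) := by ring
    _ ≤ (e * n / s) ^ s * 2 ^ s * y ^ (3 * s) := by gcongr
    _ = (e * n / s * 2 * y ^ 3) ^ s := by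
        rw [pow_mul, ← mul_pow, ← mul_pow]
    _ = (16000 * e ^ 4 * (s / n) * (s / n)) ^ s := by
        congr 1
        rw [hy]
        field_simp
        ring
    _ ≤ (1 / 2 * (s / n)) ^ s := by
        gcongr
        nlinarith
    _ = (1 / 2) ^ s * (s / n) ^ s := mul_pow _ _ _
    _ ≤ (1 / 2) ^ s * (s / n) := by
        gcongr
        exact pow_le_of_le_one hsn0.le (by linarith) hs0.ne'
    _ = _ := by ring

/-- For `n p` large, having many deficient vertices is unlikely. -/
theorem measureReal_many_deficient_le {n : ℕ} (hn : 3 ∣ n) {p : ℝ} (hp0 : 0 ≤ p) (hp1 : p ≤ 1)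
    (hd : 20000 ≤ n * p) (s : ℕ) (hs0 : 0 < s) (hs : (s : ℝ) ≤ n / 1000000)
    (hs1 : Real.exp (-(n * p / 600)) * n / 2 ≤ s) :
    (plantedMeasure n p).real
        {ω | s ≤ #(deficientVerts n (plantedGraph n ω) (n * p))} ≤
      Real.exp (-(n * p / 600)) ^ s := by
  have := isProbabilityMeasure_plantedMeasure n hp0 hp1
  have hs0' : (0 : ℝ) < s := by exact_mod_cast hs0
  refine (measureReal_mono ?_ (measure_ne_top _ _)).trans
    ((measureReal_exists_edges_deficient_le hn hp0 hp1 s 0 s hs).trans ?_)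
  · intro ω hω
    obtain ⟨S, hS, hSs⟩ := exists_subset_card_eq hω
    exact ⟨S, hSs, Nat.zero_le _, by rw [inter_eq_left.2 hS, hSs]⟩
  set x := Real.exp (-(n * p / 600)) with hx
  have hx0 : 0 < x := Real.exp_pos _
  have hxs : x ≤ 1 / 34 := by
    rw [hx, Real.exp_neg, one_div]
    gcongr
    linarith [Real.add_one_le_exp (n * p / 600)]
  have hx3 : Real.exp (-(n * p) / 200) = x ^ 3 := by
    rw [hx, ← Real.exp_nat_mul]
    congr 1
    push_cast
    ring
  have he := Real.exp_one_lt_d9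
  have he0 := Real.exp_pos 1
  have h3 := choose_le_exp_mul_div_pow n s hs0
  set e := Real.exp 1
  rw [hx3]
  calc (n.choose s : ℝ) * 2 ^ s * (s.choose 2).choose 0 * p ^ 0 * (2 * x ^ 3) ^ s
      = n.choose s * 2 ^ s * (2 * x ^ 3) ^ s := by simp
    _ ≤ (e * n / s) ^ s * 2 ^ s * (2 * x ^ 3) ^ s := by gcongr
    _ = (e * n / s * 2 * (2 * x ^ 3)) ^ s := by rw [← mul_pow, ← mul_pow]
    _ ≤ x ^ s := by
        gcongr
        have h4 : x * n / s ≤ 2 := by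
          rw [div_le_iff₀ hs0']
          linarith
        calc e * n / s * 2 * (2 * x ^ 3) = 4 * e * x ^ 2 * (x * n / s) := by ring
          _ ≤ 4 * e * x ^ 2 * 2 := by gcongr
          _ = (8 * e * x) * x := by ring
          _ ≤ 1 * x := by
              gcongr
              nlinarith
          _ = x := one_mul x

theorem two_mul_exp_three_mul_le_exp {d : ℝ} (hd : 20000 ≤ d) :
    2 * Real.exp 1 ^ 3 * d ≤ Real.exp (d / 400) := by
  have h := Real.pow_div_factorial_le_exp (d / 400) (by positivity) 5
  refine le_trans ?_ h
  have he : Real.exp 1 ^ 3 ≤ 21 := by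
    calc Real.exp 1 ^ 3 ≤ 2.7182818286 ^ 3 := by
          gcongr
          exact Real.exp_one_lt_d9.le
      _ ≤ 21 := by norm_num
  have h4 : (20000 : ℝ) ^ 4 ≤ d ^ 4 := by gcongr
  have h5 : (5).factorial = 120 := rfl
  rw [h5, div_pow, div_div, le_div_iff₀ (by norm_num)]
  calc 2 * Real.exp 1 ^ 3 * d * (400 ^ 5 * (120 : ℕ)) ≤ 2 * 21 * d * (400 ^ 5 * (120 : ℕ)) := by
        gcongr
    _ ≤ 20000 ^ 4 * d := by
        push_cast
        nlinarith
    _ ≤ d ^ 4 * d := by gcongr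
    _ = d ^ 5 := by ring

/-- For `n p` large, a set of `s` vertices spanning at least `s - 1` edges and consisting of
deficient vertices at least by half is unlikely. -/
theorem measureReal_exists_half_deficient_le {n : ℕ} (hn : 3 ∣ n) {p : ℝ} (hp0 : 0 ≤ p)
    (hp1 : p ≤ 1) (hd : 20000 ≤ n * p) (s : ℕ) (hs0 : 2 ≤ s) (hs : (s : ℝ) ≤ n / 1000000) :
    (plantedMeasure n p).real {ω | ∃ S : Finset (Fin n), #S = s ∧
        #S ≤ #(edgesIn (plantedGraph n ω) S) + 1 ∧
        #S ≤ 2 * #(S ∩ deficientVerts n (plantedGraph n ω) (n * p))} ≤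
      n * Real.exp (-s) := by
  have := isProbabilityMeasure_plantedMeasure n hp0 hp1
  obtain ⟨k, rfl⟩ : ∃ k, s = k + 1 := ⟨s - 1, by omega⟩
  set s := k + 1 with hsk
  have hs0' : (1 : ℝ) ≤ s := by exact_mod_cast (by omega : 1 ≤ s)
  have hk0 : (0 : ℝ) < k := by exact_mod_cast (by omega : 0 < k)
  refine (measureReal_mono ?_ (measure_ne_top _ _)).trans
    ((measureReal_exists_edges_deficient_le hn hp0 hp1 s k ((s + 1) / 2) hs).trans ?_)
  · rintro ω ⟨S, hS, h1, h2⟩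
    exact ⟨S, hS, by omega, by omega⟩
  have he1 : 1 ≤ Real.exp 1 := Real.one_le_exp (by norm_num)
  have hexp := two_mul_exp_three_mul_le_exp hd
  have hn0 : (0 : ℝ) < n := by linarith
  set d := n * p with hdef
  have hd0 : 0 < d := by linarith
  set ρ := 2 * Real.exp (-(d / 400)) with hρ
  have hρ0 : 0 < ρ := by positivity
  have hEpos := Real.exp_pos (d / 400)
  have hρE : ρ * Real.exp (d / 400) = 2 := by
    rw [hρ, mul_assoc, ← Real.exp_add]
    simp
  have h3 := choose_le_exp_mul_div_pow n s (by omega)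
  have h4 := choose_le_exp_mul_div_pow (s.choose 2) k (by omega)
  have hsexp : Real.exp (-s : ℝ) = (Real.exp 1)⁻¹ ^ s := by
    rw [← Real.exp_neg, ← Real.exp_nat_mul]
    congr 1
    ring
  rw [hsexp]
  set e := Real.exp 1
  have he0 : 0 < e := by linarith
  have hdρ : e ^ 2 * d * ρ ≤ e⁻¹ := by
    rw [← one_div, le_div_iff₀ he0]
    have : 2 * (e ^ 2 * d * ρ * e) ≤ 2 * 1 := by
      calc 2 * (e ^ 2 * d * ρ * e) = ρ * (2 * e ^ 3 * d) := by ring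
        _ ≤ ρ * Real.exp (d / 400) := by gcongr
        _ = 2 * 1 := by rw [hρE]; ring
    linarith
  have hρ1 : ρ ≤ 1 := by
    have h : Real.exp (d / 400) ≥ 2 := by linarith [Real.add_one_le_exp (d / 400)]
    nlinarith
  have hq : (2 * Real.exp (-d / 200)) ^ ((s + 1) / 2) ≤ ρ ^ s := by
    calc (2 * Real.exp (-d / 200)) ^ ((s + 1) / 2) ≤ (ρ ^ 2) ^ ((s + 1) / 2) := by
          gcongr
          rw [hρ, mul_pow, ← Real.exp_nat_mul]
          have : Real.exp (-d / 200) = Real.exp (((2 : ℕ) : ℝ) * -(d / 400)) := by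
            congr 1
            push_cast
            ring
          rw [this]
          gcongr
          norm_num
      _ = ρ ^ (2 * ((s + 1) / 2)) := by rw [pow_mul]
      _ ≤ ρ ^ s := pow_le_pow_of_le_one hρ0.le hρ1 (by omega)
  have hs2 : ((s.choose 2 : ℕ) : ℝ) = s * k / 2 := by
    rw [Nat.cast_choose_two, hsk]
    push_cast
    ring
  have hfac : (e * n / s) ^ s * ((e * (s.choose 2 : ℕ) / k) ^ k * p ^ k) ≤
      n * (e ^ 2 * d / 2) ^ s := by
    calc (e * n / s) ^ s * ((e * (s.choose 2 : ℕ) / k) ^ k * p ^ k)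
        = (e * n / s) * (e * n / s * (e * (s.choose 2 : ℕ) / k * p)) ^ k := by
          rw [hsk, pow_succ (e * n / (k + 1 : ℕ)) k, mul_pow, mul_pow]
          ring
      _ = (e * n / s) * (e ^ 2 * d / 2) ^ k := by
          rw [hs2, hdef]
          congr 2
          field_simp
      _ ≤ (e * n) * (e ^ 2 * d / 2) ^ k := by
          gcongr
          exact div_le_self (by positivity) hs0'
      _ = n * ((e ^ 2 * d / 2) ^ k * e) := by ring
      _ ≤ n * ((e ^ 2 * d / 2) ^ k * (e ^ 2 * d / 2)) := by
          gcongr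
          nlinarith
      _ = _ := by rw [hsk, pow_succ (e ^ 2 * d / 2) k]
  calc (n.choose s : ℝ) * 2 ^ s * (s.choose 2).choose k * p ^ k *
        (2 * Real.exp (-d / 200)) ^ ((s + 1) / 2)
      ≤ (e * n / s) ^ s * 2 ^ s * (e * (s.choose 2 : ℕ) / k) ^ k * p ^ k * ρ ^ s := by gcongr
    _ = 2 ^ s * ρ ^ s * ((e * n / s) ^ s * ((e * (s.choose 2 : ℕ) / k) ^ k * p ^ k)) := by ring
    _ ≤ 2 ^ s * ρ ^ s * (n * (e ^ 2 * d / 2) ^ s) := by gcongr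
    _ = n * (2 * ρ * (e ^ 2 * d / 2)) ^ s := by
        rw [mul_left_comm, ← mul_pow, ← mul_pow]
    _ = n * (e ^ 2 * d * ρ) ^ s := by
        congr 2
        ring
    _ ≤ n * e⁻¹ ^ s := by gcongr

theorem isCore_compl_of_deficientVerts_subset {n : ℕ} {G : SimpleGraph (Fin n)} {d : ℝ}
    {W : Finset (Fin n)} (hB : deficientVerts n G d ⊆ W)
    (hW : ∀ v, v ∉ W → (#(nbrsIn G W v) : ℝ) ≤ d / 20) :
    IsCore n G d (W : Set (Fin n))ᶜ := by
  intro v hv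
  have hvW : v ∉ W := by simpa using hv
  have hnbrs : {w : Fin n | G.Adj v w ∧ w ∉ (W : Set (Fin n))ᶜ} = nbrsIn G W v := by
    ext w
    simp [nbrsIn, and_comm]
  refine ⟨fun i hi => ?_, ?_⟩
  · have h1 : d / 4 ≤ (#{w | G.Adj v w ∧ plantedColoring n w = i} : ℝ) := by
      by_contra! h
      exact hvW (hB (mem_filter.2 ⟨mem_univ _, i, hi, h⟩))
    have h2 : {w : Fin n | G.Adj v w ∧ w ∈ (W : Set (Fin n))ᶜ ∧ plantedColoring n w = i} =
        (univ.filter fun w => G.Adj v w ∧ w ∉ W ∧ plantedColoring n w = i : Finset (Fin n)) := by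
      ext w
      simp
    have h3 : (univ.filter fun w => G.Adj v w ∧ plantedColoring n w = i) ⊆
        (univ.filter fun w => G.Adj v w ∧ w ∉ W ∧ plantedColoring n w = i) ∪ nbrsIn G W v := by
      intro w hw
      obtain ⟨-, hadj, hi⟩ := mem_filter.1 hw
      by_cases hwW : w ∈ W
      · exact mem_union_right _ (mem_filter.2 ⟨hwW, hadj⟩)
      · exact mem_union_left _ (mem_filter.2 ⟨mem_univ _, hadj, hwW, hi⟩)
    have h4 : (#{w | G.Adj v w ∧ plantedColoring n w = i} : ℝ) ≤
        #(univ.filter fun w => G.Adj v w ∧ w ∉ W ∧ plantedColoring n w = i) +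
          #(nbrsIn G W v) := by
      exact_mod_cast (card_le_card h3).trans (card_union_le _ _)
    rw [h2, Set.ncard_coe_finset]
    linarith [hW v hvW]
  · rw [hnbrs, Set.ncard_coe_finset]
    exact hW v hvW

theorem sum_mul_half_pow_le (k : ℕ) : ∑ s ∈ range k, (s : ℝ) * (1 / 2) ^ s ≤ 2 := by
  have h : ∑ s ∈ range k, (s : ℝ) * (1 / 2) ^ s = 2 - (2 * k + 2) * (1 / 2) ^ k := by
    induction k with
    | zero => norm_num
    | succ k ih =>
      rw [sum_range_succ, ih, pow_succ]
      push_cast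
      ring
  rw [h]
  have : (0 : ℝ) ≤ (2 * k + 2) * (1 / 2) ^ k := by positivity
  linarith

/-- Local sparsity fails with probability `O(1 / n)`. -/
theorem measureReal_not_sparse_le {n : ℕ} (hn : 3 ∣ n) {p : ℝ} (hp0 : 0 ≤ p) (hp1 : p ≤ 1)
    (hd : 120 ≤ n * p) (m : ℕ) (hm : (m : ℝ) ≤ n / 2000000) :
    (plantedMeasure n p).real {ω | ∃ S : Finset (Fin n), S.Nonempty ∧ #S ≤ m ∧
        n * p / 20 / 2 * #S ≤ (#(edgesIn (plantedGraph n ω) S) : ℝ)} ≤ 2 / n := by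
  have := isProbabilityMeasure_plantedMeasure n hp0 hp1
  have hsub : {ω | ∃ S : Finset (Fin n), S.Nonempty ∧ #S ≤ m ∧
        n * p / 20 / 2 * #S ≤ (#(edgesIn (plantedGraph n ω) S) : ℝ)} ⊆
      ⋃ s ∈ (range (m + 1)).filter (0 < ·), {ω | ∃ S : Finset (Fin n), #S = s ∧
        n * p / 40 * s ≤ (#(edgesIn (plantedGraph n ω) S) : ℝ)} := by
    rintro ω ⟨S, hS, hSm, h⟩
    simp only [Set.mem_iUnion, Set.mem_ofPred_eq, exists_prop, mem_filter, mem_range]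
    refine ⟨#S, ⟨by omega, hS.card_pos⟩, S, rfl, le_trans (le_of_eq (by ring)) h⟩
  refine (measureReal_mono hsub (measure_ne_top _ _)).trans
    ((measureReal_biUnion_finset_le _ _).trans ?_)
  calc _ ≤ ∑ s ∈ (range (m + 1)).filter (0 < ·), (s : ℝ) * (1 / 2) ^ s / n := by
        refine sum_le_sum fun s hs => ?_
        obtain ⟨hs, hs0⟩ := mem_filter.1 hs
        have hsm : (s : ℝ) ≤ m := by exact_mod_cast Nat.lt_succ_iff.1 (mem_range.1 hs)
        exact measureReal_exists_dense_le hn hp0 hp1 hd s hs0 (hsm.trans hm)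
    _ ≤ ∑ s ∈ range (m + 1), (s : ℝ) * (1 / 2) ^ s / n :=
        sum_le_sum_of_subset_of_nonneg (filter_subset _ _) fun _ _ _ => by positivity
    _ ≤ 2 / n := by
        rw [← sum_div]
        gcongr
        exact sum_mul_half_pow_le _

/-- Large sets that satisfy the necessary conditions for components outside the core exist with
probability at most `1 / n`. -/
theorem measureReal_exists_large_half_deficient_le {n : ℕ} (hn : 3 ∣ n) {p : ℝ} (hp0 : 0 ≤ p)
    (hp1 : p ≤ 1) (hd : 20000 ≤ n * p) (m : ℕ) (hm : (m : ℝ) ≤ n / 1000000) (hmn : m < n)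
    (hlog : 1 ≤ Real.log n) :
    (plantedMeasure n p).real {ω | ∃ S : Finset (Fin n), #S ≤ m ∧ 3 * Real.log n < (#S : ℝ) ∧
        #S ≤ #(edgesIn (plantedGraph n ω) S) + 1 ∧
        #S ≤ 2 * #(S ∩ deficientVerts n (plantedGraph n ω) (n * p))} ≤ 1 / n := by
  have := isProbabilityMeasure_plantedMeasure n hp0 hp1
  have hn0 : (0 : ℝ) < n := by exact_mod_cast (by omega : 0 < n)
  have hsub : {ω | ∃ S : Finset (Fin n), #S ≤ m ∧ 3 * Real.log n < (#S : ℝ) ∧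
        #S ≤ #(edgesIn (plantedGraph n ω) S) + 1 ∧
        #S ≤ 2 * #(S ∩ deficientVerts n (plantedGraph n ω) (n * p))} ⊆
      ⋃ s ∈ (range (m + 1)).filter (fun s : ℕ => 3 * Real.log n < (s : ℝ)),
        {ω | ∃ S : Finset (Fin n), #S = s ∧ #S ≤ #(edgesIn (plantedGraph n ω) S) + 1 ∧
          #S ≤ 2 * #(S ∩ deficientVerts n (plantedGraph n ω) (n * p))} := by
    rintro ω ⟨S, hSm, hS, h⟩
    simp only [Set.mem_iUnion, Set.mem_ofPred_eq, exists_prop, mem_filter, mem_range]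
    exact ⟨#S, ⟨by omega, hS⟩, S, rfl, h⟩
  refine (measureReal_mono hsub (measure_ne_top _ _)).trans
    ((measureReal_biUnion_finset_le _ _).trans ?_)
  have hterm : ∀ s ∈ (range (m + 1)).filter (fun s : ℕ => 3 * Real.log n < (s : ℝ)),
      (plantedMeasure n p).real
        {ω | ∃ S : Finset (Fin n), #S = s ∧ #S ≤ #(edgesIn (plantedGraph n ω) S) + 1 ∧
          #S ≤ 2 * #(S ∩ deficientVerts n (plantedGraph n ω) (n * p))} ≤ 1 / (n : ℝ) ^ 2 := by
    intro s hs
    obtain ⟨hs, hs0⟩ := mem_filter.1 hs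
    have hsm : (s : ℝ) ≤ m := by exact_mod_cast Nat.lt_succ_iff.1 (mem_range.1 hs)
    have hs2 : (2 : ℝ) ≤ s := by linarith
    refine (measureReal_exists_half_deficient_le hn hp0 hp1 hd s (by exact_mod_cast hs2)
      (hsm.trans hm)).trans ?_
    have h3 : Real.exp (-s) ≤ 1 / (n : ℝ) ^ 3 := by
      calc Real.exp (-s) ≤ Real.exp (-((3 : ℕ) * Real.log n)) := by
            gcongr
            push_cast
            linarith
        _ = _ := by rw [Real.exp_neg, Real.exp_nat_mul, Real.exp_log hn0, one_div]
    calc n * Real.exp (-s) ≤ n * (1 / (n : ℝ) ^ 3) := by gcongr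
      _ = _ := by field_simp
  refine (sum_le_card_nsmul _ _ _ hterm).trans ?_
  have hcard : (#((range (m + 1)).filter (fun s : ℕ => 3 * Real.log n < (s : ℝ))) : ℝ) ≤ n := by
    have := card_filter_le (range (m + 1)) (fun s : ℕ => 3 * Real.log n < (s : ℝ))
    rw [card_range] at this
    exact_mod_cast this.trans hmn
  rw [nsmul_eq_mul]
  calc _ ≤ (n : ℝ) * (1 / (n : ℝ) ^ 2) := by gcongr
    _ = _ := by field_simp

theorem exp_neg_le_of_le {y : ℝ} (hy : 33 ≤ y) : Real.exp (-y) ≤ 1 / 4000000 := by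
  have h := Real.pow_div_factorial_le_exp y (by linarith) 7
  have h7 : (33 : ℝ) ^ 7 ≤ y ^ 7 := by gcongr
  have hf : ((7).factorial : ℝ) = 5040 := by norm_num [Nat.factorial]
  rw [hf] at h
  rw [Real.exp_neg, one_div]
  gcongr
  norm_num at h7
  linarith

/-- More than `exp (-n p / 600) n / 2` deficient vertices are unlikely, uniformly in `p`. -/
theorem measureReal_lt_card_deficientVerts_le {n : ℕ} (hn : 3 ∣ n) {p : ℝ} (hp0 : 0 ≤ p)
    (hp1 : p ≤ 1) (hd : 20000 ≤ n * p) (hnl : 8000000 ≤ n) :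
    (plantedMeasure n p).real {ω | Real.exp (-(n * p / 600)) * n / 2 <
        (#(deficientVerts n (plantedGraph n ω) (n * p)) : ℝ)} ≤
      Real.exp (-(Real.log (n / 2) / 2)) := by
  have := isProbabilityMeasure_plantedMeasure n hp0 hp1
  have hnl' : (8000000 : ℝ) ≤ n := by exact_mod_cast hnl
  set y := n * p / 600 with hy
  have hy33 : 33 ≤ y := by
    rw [hy]
    linarith
  set x := Real.exp (-y) with hx
  have hx0 : 0 < x := Real.exp_pos _
  have hx1 : x ≤ 1 / 4000000 := exp_neg_le_of_le hy33
  set s := ⌊x * n / 2⌋₊ + 1 with hs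
  have hxs : x * n / 2 < s := by
    rw [hs]
    push_cast
    exact Nat.lt_floor_add_one _
  have hs1 : (1 : ℝ) ≤ s := by
    rw [hs]
    push_cast
    linarith [Nat.cast_nonneg (α := ℝ) ⌊x * n / 2⌋₊]
  have hsle : (s : ℝ) ≤ x * n / 2 + 1 := by
    rw [hs]
    push_cast
    linarith [Nat.floor_le (by positivity : 0 ≤ x * n / 2)]
  have hsn : (s : ℝ) ≤ n / 1000000 := by nlinarith
  refine (measureReal_mono ?_ (measure_ne_top _ _)).trans
    ((measureReal_many_deficient_le hn hp0 hp1 hd s (by omega) hsn hxs.le).trans ?_)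
  · intro ω (hω : x * n / 2 < _)
    exact Nat.succ_le_of_lt ((Nat.floor_lt (by positivity)).2 hω)
  · rw [← Real.exp_nat_mul]
    gcongr
    have h1 : Real.log (n / 2) ≤ y + x * n / 2 := by
      have h := Real.add_one_le_exp (Real.log (n / 2) - y)
      rw [sub_eq_add_neg, Real.exp_add, Real.exp_log (by positivity), ← hx] at h
      linarith
    nlinarith [mul_nonneg (sub_nonneg.2 hs1) (by linarith : (0 : ℝ) ≤ y - 1)]

theorem eventually_failure_bound_le {δ : ℝ} (hδ : 0 < δ) :
    ∀ᶠ n : ℕ in Filter.atTop,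
      2 / (n : ℝ) + 1 / n + Real.exp (-(Real.log (n / 2) / 2)) ≤ δ := by
  have h1 : Filter.Tendsto (fun n : ℕ => 2 / (n : ℝ)) Filter.atTop (nhds 0) :=
    tendsto_const_div_atTop_nhds_zero_nat 2
  have h2 : Filter.Tendsto (fun n : ℕ => 1 / (n : ℝ)) Filter.atTop (nhds 0) :=
    tendsto_const_div_atTop_nhds_zero_nat 1
  have h3 : Filter.Tendsto (fun n : ℕ => Real.exp (-(Real.log ((n : ℝ) / 2) / 2)))
      Filter.atTop (nhds 0) := by
    refine Real.tendsto_exp_neg_atTop_nhds_zero.comp ?_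
    refine Filter.Tendsto.atTop_div_const (by norm_num) (Real.tendsto_log_atTop.comp ?_)
    exact tendsto_natCast_atTop_atTop.atTop_div_const (by norm_num)
  have h := (h1.add h2).add h3
  simp only [add_zero] at h
  exact h.eventually_le_const hδ

end PlantedModel

end

/-- whp the planted graph admits a large `(np)`-core such that every connected
component of the graph induced on the complement of the core has `O(log n)` vertices. -/
theorem exists_large_core_small_components :
    ∃ C0 c C : ℝ, 0 < C0 ∧ 0 < c ∧ 0 < C ∧
      ∀ δ : ℝ, 0 < δ → ∃ N : ℕ,
        ∀ n : ℕ, N ≤ n → 3 ∣ n → ∀ p : ℝ, 0 ≤ p → p ≤ 1 → C0 ≤ n * p →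
          ENNReal.ofReal (1 - δ) ≤
            plantedMeasure n p {ω : BichromPair n → Bool |
              ∃ D : Set (Fin n), IsCore n (plantedGraph n ω) (n * p) D ∧
                (1 - Real.exp (-(c * n * p))) * n ≤ (D.ncard : ℝ) ∧
                ∀ comp : (SimpleGraph.induce Dᶜ (plantedGraph n ω)).ConnectedComponent,
                  (comp.supp.ncard : ℝ) ≤ C * Real.log n} := by
  classical
  refine ⟨20000, 1 / 600, 3, by norm_num, by norm_num, by norm_num, fun δ hδ => ?_⟩
  obtain ⟨N, hN⟩ := Filter.eventually_atTop.1 (eventually_failure_bound_le hδ)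
  refine ⟨max N 8000000, fun n hn h3 p hp0 hp1 hd => ?_⟩
  have hnN : N ≤ n := (le_max_left _ _).trans hn
  have hnl : 8000000 ≤ n := (le_max_right _ _).trans hn
  have hnl' : (8000000 : ℝ) ≤ n := by exact_mod_cast hnl
  have := isProbabilityMeasure_plantedMeasure n hp0 hp1
  set μ := plantedMeasure n p
  set good := {ω : BichromPair n → Bool |
    ∃ D : Set (Fin n), IsCore n (plantedGraph n ω) (n * p) D ∧
      (1 - Real.exp (-(1 / 600 * n * p))) * n ≤ (D.ncard : ℝ) ∧
      ∀ comp : (SimpleGraph.induce Dᶜ (plantedGraph n ω)).ConnectedComponent,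
        (comp.supp.ncard : ℝ) ≤ 3 * Real.log n} with hgood
  set m := ⌊(n : ℝ) / 2000000⌋₊
  have hm : (m : ℝ) ≤ n / 2000000 := Nat.floor_le (by positivity)
  have hm' : (n : ℝ) / 2000000 - 1 < m := Nat.sub_one_lt_floor _
  have hmn : m < n := by
    have : (m : ℝ) < n := by linarith
    exact_mod_cast this
  have hlog : 1 ≤ Real.log n := by
    rw [Real.le_log_iff_exp_le (by linarith)]
    linarith [Real.exp_one_lt_d9]
  have hE1 := measureReal_not_sparse_le h3 hp0 hp1 (by linarith) m hm
  have hE2 := measureReal_exists_large_half_deficient_le h3 hp0 hp1 hd m (by linarith) hmn hlog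
  have hE3 := measureReal_lt_card_deficientVerts_le h3 hp0 hp1 hd hnl
  set E1 := {ω | ∃ S : Finset (Fin n), S.Nonempty ∧ S.card ≤ m ∧
    n * p / 20 / 2 * S.card ≤ ((edgesIn (plantedGraph n ω) S).card : ℝ)}
  set E2 := {ω | ∃ S : Finset (Fin n), S.card ≤ m ∧ 3 * Real.log n < (S.card : ℝ) ∧
    S.card ≤ (edgesIn (plantedGraph n ω) S).card + 1 ∧
    S.card ≤ 2 * (S ∩ deficientVerts n (plantedGraph n ω) (n * p)).card}
  set E3 := {ω | Real.exp (-(n * p / 600)) * n / 2 <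
    ((deficientVerts n (plantedGraph n ω) (n * p)).card : ℝ)}
  have hcover : (Set.univ : Set (BichromPair n → Bool)) ⊆ good ∪ (E1 ∪ E2 ∪ E3) := by
    intro ω _
    by_contra hω
    simp only [Set.mem_union, not_or] at hω
    obtain ⟨hbad, ⟨h1, h2⟩, h3⟩ := hω
    refine hbad ?_
    set G := plantedGraph n ω
    set B := deficientVerts n G (n * p)
    have hB : (B.card : ℝ) ≤ Real.exp (-(n * p / 600)) * n / 2 := not_lt.1 h3
    have hx : Real.exp (-(n * p / 600)) ≤ 1 / 4000000 := exp_neg_le_of_le (by linarith)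
    have hBm : 2 * B.card < m := by
      have : (2 * B.card : ℝ) < m := by nlinarith
      exact_mod_cast this
    obtain ⟨W, hBW, hW2, hWcl, hWcomp⟩ := exists_infection_closure G
      (θ := n * p / 20) (by linarith) B m
      (fun S hS hSm => by
        by_contra! h
        exact h1 ⟨S, hS, hSm, h⟩) hBm
    refine ⟨(W : Set (Fin n))ᶜ, isCore_compl_of_deficientVerts_subset hBW hWcl, ?_,
      fun comp => ?_⟩
    · have hW : (W.card : ℝ) ≤ 2 * B.card := by exact_mod_cast hW2
      have hcard : (((W : Set (Fin n))ᶜ.ncard : ℕ) : ℝ) = n - W.card := by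
        rw [← Finset.coe_compl, Set.ncard_coe_finset, Finset.card_compl, Fintype.card_fin,
          Nat.cast_sub (by simpa using W.card_le_univ)]
      have hexp : -(1 / 600 * n * p : ℝ) = -(n * p / 600) := by ring
      rw [hcard, hexp]
      linarith
    · obtain ⟨S, hS, hSW, hScard, hSe, hSiso⟩ := card_supp_le_card_edgesIn G _ comp
      rw [compl_compl] at hSW hSiso
      rw [← hScard]
      by_contra! hlarge
      have hSW' : S ⊆ W := by exact_mod_cast hSW
      have hSm : S.card ≤ m := (Finset.card_le_card hSW').trans (hW2.trans hBm.le)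
      exact h2 ⟨S, hSm, hlarge, hSe, hWcomp S hSW' hS hSiso⟩
  have hone : 1 ≤ μ.real good + (μ.real E1 + μ.real E2 + μ.real E3) := by
    calc (1 : ℝ) = μ.real Set.univ := probReal_univ.symm
      _ ≤ μ.real (good ∪ (E1 ∪ E2 ∪ E3)) := measureReal_mono hcover
      _ ≤ μ.real good + μ.real (E1 ∪ E2 ∪ E3) := measureReal_union_le _ _
      _ ≤ μ.real good + (μ.real E1 + μ.real E2 + μ.real E3) := by
          gcongr
          refine (measureReal_union_le _ _).trans ?_
          gcongr
          exact measureReal_union_le _ _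
  refine ENNReal.ofReal_le_of_le_toReal ?_
  have := hN n hnN
  change 1 - δ ≤ μ.real good
  linarith
end

section
/- There exist constants C0 > 0, c > 0 and N such that for every n ≥ N divisible by 3 and every p with n·p ≥ C0, with probability at least 1 − e^{−c·n·p} a sample G ~ 𝒢_{n,p,3} admits an (n·p)-core D ⊆ V with |D| ≥ (1 − e^{−c·n·p})·n such that the induced subgraph G[V ∖ D] contains no cycle (it is a forest). -/
open MeasureTheory

section BernoulliProduct

variable {ι : Type*} [Fintype ι]

/-- The weight of the sample point `ω` under the product of Bernoulli(p) measures. -/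
noncomputable def bernoulliWeight (p : ℝ) (ω : ι → Bool) : ℝ := ∏ e, if ω e then p else 1 - p

lemma bernoulliWeight_nonneg {p : ℝ} (h0 : 0 ≤ p) (h1 : p ≤ 1) (ω : ι → Bool) :
    0 ≤ bernoulliWeight p ω := by
  refine Finset.prod_nonneg fun e _ => ?_
  split_ifs <;> linarith

variable [DecidableEq ι]

/-- The expectation of `f` under the product of Bernoulli(p) measures. -/
noncomputable def bernoulliExpect (p : ℝ) (f : (ι → Bool) → ℝ) : ℝ :=
  ∑ ω, bernoulliWeight p ω * f ω

/-- The probability of `A` under the product of Bernoulli(p) measures. -/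
noncomputable def bernoulliProb (p : ℝ) (A : Set (ι → Bool)) : ℝ :=
  bernoulliExpect p (A.indicator 1)

lemma bernoulliExpect_mono {p : ℝ} (h0 : 0 ≤ p) (h1 : p ≤ 1) {f g : (ι → Bool) → ℝ}
    (h : ∀ ω, f ω ≤ g ω) : bernoulliExpect p f ≤ bernoulliExpect p g :=
  Finset.sum_le_sum fun ω _ => mul_le_mul_of_nonneg_left (h ω) (bernoulliWeight_nonneg h0 h1 ω)

lemma bernoulliExpect_sum {κ : Type*} (p : ℝ) (s : Finset κ) (f : κ → (ι → Bool) → ℝ) :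
    bernoulliExpect p (fun ω => ∑ k ∈ s, f k ω) = ∑ k ∈ s, bernoulliExpect p (f k) := by
  simp only [bernoulliExpect, Finset.mul_sum]
  exact Finset.sum_comm

lemma bernoulliExpect_const_mul (p a : ℝ) (f : (ι → Bool) → ℝ) :
    bernoulliExpect p (fun ω => a * f ω) = a * bernoulliExpect p f := by
  simp only [bernoulliExpect, Finset.mul_sum]
  exact Finset.sum_congr rfl fun ω _ => by ring

lemma bernoulliExpect_prod (p x : ℝ) (F : Finset ι) :
    bernoulliExpect p (fun ω => ∏ e ∈ F, if ω e then x else 1) = (1 - p + p * x) ^ F.card := by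
  have h : ∀ ω : ι → Bool, bernoulliWeight p ω * (∏ e ∈ F, if ω e then x else 1) =
      ∏ e, (if ω e then p else 1 - p) * (if e ∈ F then (if ω e then x else 1) else 1) := by
    intro ω
    rw [Finset.prod_mul_distrib, bernoulliWeight, Finset.prod_ite_mem, Finset.univ_inter]
  simp only [bernoulliExpect, h]
  have h2 := Fintype.prod_sum (κ := fun _ : ι => Bool)
    (fun (e : ι) (b : Bool) => (if b then p else 1 - p) *
      (if e ∈ F then (if b then x else 1) else 1))
  rw [← h2]
  have h3 : ∀ e : ι, (∑ b : Bool, (if b then p else 1 - p) *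
      (if e ∈ F then (if b then x else 1) else 1)) = if e ∈ F then 1 - p + p * x else 1 := by
    intro e
    by_cases he : e ∈ F <;> simp [he]
    ring
  simp only [h3, Finset.prod_ite_mem, Finset.univ_inter, Finset.prod_const]

lemma bernoulliExpect_one (p : ℝ) : bernoulliExpect p (fun _ : ι → Bool => (1 : ℝ)) = 1 := by
  simpa using bernoulliExpect_prod (ι := ι) p 1 ∅

lemma bernoulliProb_mono {p : ℝ} (h0 : 0 ≤ p) (h1 : p ≤ 1) {A B : Set (ι → Bool)}
    (h : A ⊆ B) : bernoulliProb p A ≤ bernoulliProb p B :=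
  bernoulliExpect_mono h0 h1 fun ω => Set.indicator_le_indicator_of_subset h (by simp) ω

lemma bernoulliProb_nonneg {p : ℝ} (h0 : 0 ≤ p) (h1 : p ≤ 1) (A : Set (ι → Bool)) :
    0 ≤ bernoulliProb p A :=
  Finset.sum_nonneg fun ω _ => mul_nonneg (bernoulliWeight_nonneg h0 h1 ω)
    (Set.indicator_nonneg (by simp) ω)

lemma bernoulliProb_compl (p : ℝ) (A : Set (ι → Bool)) :
    bernoulliProb p A = 1 - bernoulliProb p Aᶜ := by
  rw [eq_sub_iff_add_eq, ← bernoulliExpect_one (ι := ι) p]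
  simp only [bernoulliProb, bernoulliExpect, ← Finset.sum_add_distrib, ← mul_add]
  refine Finset.sum_congr rfl fun ω _ => ?_
  by_cases h : ω ∈ A <;> simp [h]

lemma bernoulliProb_iUnion_le {κ : Type*} {p : ℝ} (h0 : 0 ≤ p) (h1 : p ≤ 1) (s : Finset κ)
    (A : κ → Set (ι → Bool)) :
    bernoulliProb p {ω | ∃ k ∈ s, ω ∈ A k} ≤ ∑ k ∈ s, bernoulliProb p (A k) := by
  simp only [bernoulliProb]
  rw [← bernoulliExpect_sum]
  refine bernoulliExpect_mono h0 h1 fun ω => ?_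
  have hn : ∀ k ∈ s, 0 ≤ (A k).indicator (1 : (ι → Bool) → ℝ) ω :=
    fun k _ => Set.indicator_nonneg (by simp) ω
  by_cases h : ω ∈ {ω | ∃ k ∈ s, ω ∈ A k}
  · rw [Set.indicator_of_mem h]
    obtain ⟨k, hk, hA⟩ := h
    calc (1 : ℝ) = (A k).indicator (1 : (ι → Bool) → ℝ) ω := by simp [hA]
      _ ≤ _ := Finset.single_le_sum hn hk
  · rw [Set.indicator_of_notMem h]
    exact Finset.sum_nonneg hn

lemma bernoulliProb_union_le {p : ℝ} (h0 : 0 ≤ p) (h1 : p ≤ 1) (A B : Set (ι → Bool)) :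
    bernoulliProb p (A ∪ B) ≤ bernoulliProb p A + bernoulliProb p B := by
  refine (bernoulliProb_mono h0 h1 fun ω h => ?_).trans
    ((bernoulliProb_iUnion_le h0 h1 Finset.univ (fun b : Bool => if b then A else B)).trans
      (by simp))
  simpa [or_comm] using h

lemma mul_bernoulliProb_le_expect {p : ℝ} (h0 : 0 ≤ p) (h1 : p ≤ 1) {f : (ι → Bool) → ℝ}
    (hf : ∀ ω, 0 ≤ f ω) (t : ℝ) {A : Set (ι → Bool)} (hA : ∀ ω ∈ A, t ≤ f ω) :
    t * bernoulliProb p A ≤ bernoulliExpect p f := by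
  rw [bernoulliProb, ← bernoulliExpect_const_mul]
  refine bernoulliExpect_mono h0 h1 fun ω => ?_
  by_cases h : ω ∈ A
  · simpa [h] using hA ω h
  · simpa [h] using hf ω

/-- Exponential Markov inequality for the number of successes among the coordinates in `F`. -/
lemma bernoulliProb_le_exp {p : ℝ} (h0 : 0 ≤ p) (h1 : p ≤ 1) (F : Finset ι) (t r : ℝ)
    {A : Set (ι → Bool)}
    (hA : ∀ ω ∈ A, t * r ≤ t * ((F.filter fun e => ω e = true).card : ℝ)) :
    bernoulliProb p A ≤ Real.exp (-(t * r) + p * (Real.exp t - 1) * F.card) := by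
  have hprod : ∀ ω : ι → Bool, (∏ e ∈ F, if ω e then Real.exp t else 1) =
      Real.exp (t * ((F.filter fun e => ω e = true).card : ℝ)) := by
    intro ω
    rw [Finset.prod_ite, Finset.prod_const_one, mul_one, Finset.prod_const, ← Real.exp_nat_mul,
      mul_comm]
  have h := mul_bernoulliProb_le_expect h0 h1
    (f := fun ω => ∏ e ∈ F, if ω e then Real.exp t else 1)
    (fun ω => by rw [hprod]; positivity) (Real.exp (t * r)) (A := A)
    (fun ω hω => by rw [hprod]; exact Real.exp_le_exp.2 (hA ω hω))
  rw [bernoulliExpect_prod] at h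
  have h3 : (1 - p + p * Real.exp t) ^ F.card ≤ Real.exp (p * (Real.exp t - 1) * F.card) := by
    rw [mul_comm _ (F.card : ℝ), Real.exp_nat_mul]
    refine pow_le_pow_left₀ (by nlinarith [Real.exp_pos t]) ?_ _
    have := Real.add_one_le_exp (p * (Real.exp t - 1))
    linarith
  rw [Real.exp_add, Real.exp_neg, ← div_eq_inv_mul, le_div_iff₀ (Real.exp_pos _), mul_comm]
  exact h.trans h3

lemma bernoulliProb_inter_eq_true {p : ℝ} (e : ι) {B : Set (ι → Bool)}
    (hB : ∀ ω b, ω ∈ B ↔ Function.update ω e b ∈ B) :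
    bernoulliProb p (B ∩ {ω | ω e = true}) = p * bernoulliProb p B := by
  set flip : (ι → Bool) → (ι → Bool) := fun ω => Function.update ω e (!ω e) with hflip
  have hinv : Function.Involutive flip := fun ω => by simp [hflip]
  have hweight : ∀ ω, ω e = true →
      (1 - p) * bernoulliWeight p ω = p * bernoulliWeight p (flip ω) := by
    intro ω hω
    unfold bernoulliWeight
    rw [← Finset.mul_prod_erase _ _ (Finset.mem_univ e),
      ← Finset.mul_prod_erase _ (fun x => if flip ω x then p else 1 - p) (Finset.mem_univ e)]
    have : ∏ x ∈ Finset.univ.erase e, (if flip ω x then p else 1 - p) =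
        ∏ x ∈ Finset.univ.erase e, (if ω x then p else 1 - p) :=
      Finset.prod_congr rfl fun x hx => by
        simp [hflip, Function.update_of_ne (Finset.ne_of_mem_erase hx)]
    rw [this]
    simp [hflip, hω]
    ring
  have hswap : (1 - p) * bernoulliProb p (B ∩ {ω | ω e = true}) =
      p * bernoulliProb p (B ∩ {ω | ω e = false}) := by
    simp only [bernoulliProb, bernoulliExpect, Finset.mul_sum]
    rw [← Equiv.sum_comp hinv.toPerm
      (fun ω => p * (bernoulliWeight p ω * (B ∩ {ω | ω e = false}).indicator 1 ω))]
    refine Finset.sum_congr rfl fun ω _ => ?_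
    have hmem : flip ω ∈ B ↔ ω ∈ B := (hB ω _).symm
    have hval : flip ω e = !ω e := by simp [hflip]
    rw [Function.Involutive.coe_toPerm]
    by_cases h1 : ω ∈ B <;> by_cases h2 : ω e = true <;>
      simp [Set.indicator, hmem, hval, h1, h2, hweight]
  have hsum : bernoulliProb p B = bernoulliProb p (B ∩ {ω | ω e = true}) +
      bernoulliProb p (B ∩ {ω | ω e = false}) := by
    simp only [bernoulliProb, bernoulliExpect, ← Finset.sum_add_distrib, ← mul_add]
    refine Finset.sum_congr rfl fun ω _ => ?_
    by_cases h1 : ω ∈ B <;> by_cases h2 : ω e = true <;> simp [Set.indicator, h1, h2]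
  rw [hsum]
  linarith

/-- Successes on `C` are independent of an event which does not depend on the coordinates
in `C`. -/
lemma bernoulliProb_inter_forall_true {p : ℝ} (C : Finset ι) {B : Set (ι → Bool)}
    (hB : ∀ ω ω', (∀ e, e ∉ C → ω e = ω' e) → ω ∈ B → ω' ∈ B) :
    bernoulliProb p (B ∩ {ω | ∀ e ∈ C, ω e = true}) = p ^ C.card * bernoulliProb p B := by
  induction C using Finset.induction_on generalizing B with
  | empty => simp
  | insert a s ha ih =>
    have hset : B ∩ {ω | ∀ e ∈ insert a s, ω e = true} =
        (B ∩ {ω | ω a = true}) ∩ {ω | ∀ e ∈ s, ω e = true} := by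
      ext ω
      simp [and_assoc]
    rw [hset, ih, bernoulliProb_inter_eq_true, Finset.card_insert_of_notMem ha, pow_succ, mul_assoc]
    · intro ω b
      constructor <;> refine hB _ _ fun e he => ?_ <;>
        simp [Function.update_of_ne (fun h : e = a => he (by simp [h]))]
    · rintro ω ω' h ⟨h1, h2⟩
      exact ⟨hB ω ω' (fun e he => h e fun h => he (by simp [h])) h1, (h a ha).symm.trans h2⟩

end BernoulliProduct

instance (p : ℝ) : IsFiniteMeasure (bernoulliMeasure p) := by
  unfold bernoulliMeasure
  refine ⟨?_⟩
  simp

lemma plantedMeasure_eq_ofReal {n : ℕ} {p : ℝ} (h0 : 0 ≤ p) (h1 : p ≤ 1)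
    (A : Set (BichromPair n → Bool)) :
    plantedMeasure n p A = ENNReal.ofReal (bernoulliProb p A) := by
  classical
  have hs : ∀ ω, plantedMeasure n p {ω} = ENNReal.ofReal (bernoulliWeight p ω) := by
    intro ω
    rw [plantedMeasure, Measure.pi_singleton, bernoulliWeight,
      ENNReal.ofReal_prod_of_nonneg (fun e _ => by split_ifs <;> linarith)]
    refine Finset.prod_congr rfl fun e _ => ?_
    rcases h : ω e <;> simp [bernoulliMeasure]
  have hA : A = (Finset.univ.filter (· ∈ A) : Finset (BichromPair n → Bool)) := by
    ext; simp
  conv_lhs => rw [hA]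
  rw [← MeasureTheory.sum_measure_singleton, bernoulliProb, bernoulliExpect,
    ENNReal.ofReal_sum_of_nonneg, Finset.sum_filter]
  · refine Finset.sum_congr rfl fun ω _ => ?_
    by_cases h : ω ∈ A <;> simp [h, hs]
  · exact fun ω _ => mul_nonneg (bernoulliWeight_nonneg h0 h1 ω) (Set.indicator_nonneg (by simp) ω)

section Peeling

variable {n : ℕ}

/-- The vertices having fewer than `a` neighbours in some colour class other than their own. -/
def lowDegree (n : ℕ) (G : SimpleGraph (Fin n)) (a : ℝ) : Set (Fin n) :=
  {v | ∃ i : Fin 3, i ≠ plantedColoring n v ∧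
    ({w : Fin n | G.Adj v w ∧ plantedColoring n w = i}.ncard : ℝ) < a}

/-- The smallest set containing `lowDegree n G a` and every vertex with more than `b` neighbours
in the set. -/
def peel (n : ℕ) (G : SimpleGraph (Fin n)) (a b : ℝ) : Set (Fin n) :=
  ⋂₀ {W | lowDegree n G a ⊆ W ∧
    ∀ v, b < ({w : Fin n | G.Adj v w ∧ w ∈ W}.ncard : ℝ) → v ∈ W}

lemma lowDegree_subset_peel (G : SimpleGraph (Fin n)) (a b : ℝ) :
    lowDegree n G a ⊆ peel n G a b :=
  Set.subset_sInter fun _ hW => hW.1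

lemma peel_subset {G : SimpleGraph (Fin n)} {a b : ℝ} {W : Set (Fin n)}
    (h : lowDegree n G a ⊆ W)
    (h' : ∀ v, b < ({w : Fin n | G.Adj v w ∧ w ∈ W}.ncard : ℝ) → v ∈ W) : peel n G a b ⊆ W :=
  Set.sInter_subset_of_mem ⟨h, h'⟩

lemma mem_peel_of_lt {G : SimpleGraph (Fin n)} {a b : ℝ} {v : Fin n}
    (h : b < ({w : Fin n | G.Adj v w ∧ w ∈ peel n G a b}.ncard : ℝ)) : v ∈ peel n G a b := by
  rintro W ⟨hW, hW'⟩
  refine hW' v (h.trans_le ?_)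
  refine Nat.cast_le.2 (Set.ncard_le_ncard (fun w hw => ?_) (Set.toFinite _))
  exact ⟨hw.1, peel_subset hW hW' hw.2⟩

lemma isCore_compl_peel (G : SimpleGraph (Fin n)) (d : ℝ) :
    IsCore n G d (peel n G (d / 4) (d / 20))ᶜ := by
  intro v hv
  have hout : ({w : Fin n | G.Adj v w ∧ w ∉ (peel n G (d / 4) (d / 20))ᶜ}.ncard : ℝ) ≤ d / 20 := by
    by_contra! h
    exact hv (mem_peel_of_lt (by simpa using h))
  refine ⟨fun i hi => ?_, hout⟩
  have hdeg : d / 4 ≤ ({w : Fin n | G.Adj v w ∧ plantedColoring n w = i}.ncard : ℝ) := by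
    by_contra! h
    exact hv (lowDegree_subset_peel _ _ _ ⟨i, hi, h⟩)
  have hsub : {w : Fin n | G.Adj v w ∧ plantedColoring n w = i} ⊆
      {w | G.Adj v w ∧ w ∈ (peel n G (d / 4) (d / 20))ᶜ ∧ plantedColoring n w = i} ∪
      {w | G.Adj v w ∧ w ∉ (peel n G (d / 4) (d / 20))ᶜ} := by
    intro w hw
    by_cases h : w ∈ (peel n G (d / 4) (d / 20))ᶜ
    · exact Or.inl ⟨hw.1, h, hw.2⟩
    · exact Or.inr ⟨hw.1, h⟩
  have hle := (Set.ncard_le_ncard hsub (Set.toFinite _)).trans (Set.ncard_union_le _ _)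
  have hle' : ({w : Fin n | G.Adj v w ∧ plantedColoring n w = i}.ncard : ℝ) ≤
      ({w | G.Adj v w ∧ w ∈ (peel n G (d / 4) (d / 20))ᶜ ∧ plantedColoring n w = i}.ncard : ℝ) +
      ({w | G.Adj v w ∧ w ∉ (peel n G (d / 4) (d / 20))ᶜ}.ncard : ℝ) := by
    exact_mod_cast hle
  linarith

lemma lowDegree_mono (G : SimpleGraph (Fin n)) {a a' : ℝ} (h : a ≤ a') :
    lowDegree n G a ⊆ lowDegree n G a' := fun _ ⟨i, hi, hlt⟩ => ⟨i, hi, hlt.trans_le h⟩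

lemma peel_subset_peel_of_close {G G' : SimpleGraph (Fin n)} (r : ℝ)
    (h : ∀ v (X : Set (Fin n)),
      ({w | G.Adj v w ∧ w ∈ X}.ncard : ℝ) ≤ {w | G'.Adj v w ∧ w ∈ X}.ncard + r)
    (h' : ∀ v (X : Set (Fin n)),
      ({w | G'.Adj v w ∧ w ∈ X}.ncard : ℝ) ≤ {w | G.Adj v w ∧ w ∈ X}.ncard + r)
    (a b : ℝ) : peel n G a b ⊆ peel n G' (a + r) (b - r) := by
  refine peel_subset ?_ fun v hv => mem_peel_of_lt (by linarith [h v (peel n G' (a + r) (b - r))])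
  rintro v ⟨i, hi, hlt⟩
  refine lowDegree_subset_peel _ _ _ ⟨i, hi, ?_⟩
  have := h' v {w | plantedColoring n w = i}
  simp only [Set.mem_ofPred_eq] at this
  linarith

lemma edgeCount_insert_le (G : SimpleGraph (Fin n)) {W : Set (Fin n)} {v : Fin n} (hv : v ∉ W) :
    edgeCount G W + {w | G.Adj v w ∧ w ∈ W}.ncard ≤ edgeCount G (insert v W) := by
  have hinj : Set.InjOn (fun w => s(v, w)) {w | G.Adj v w ∧ w ∈ W} := fun w _ w' _ h => by
    rcases Sym2.eq_iff.1 h with h | h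
    exacts [h.2, h.2.trans h.1]
  rw [edgeCount, edgeCount, ← hinj.ncard_image, ← Set.ncard_union_eq]
  · refine Set.ncard_le_ncard ?_ (Set.toFinite _)
    rintro e (⟨he, hW⟩ | ⟨w, ⟨hvw, hw⟩, rfl⟩)
    · exact ⟨he, fun x hx => Or.inr (hW x hx)⟩
    · refine ⟨hvw, fun x hx => ?_⟩
      rcases Sym2.mem_iff.1 hx with rfl | rfl
      · exact Or.inl rfl
      · exact Or.inr hw
  · rw [Set.disjoint_left]
    rintro e ⟨he, hW⟩ ⟨w, ⟨hvw, hw⟩, rfl⟩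
    exact hv (hW v (Sym2.mem_mk_left v w))

/-- Stopping the peeling procedure when it has reached size `j` gives a set spanning many
edges. -/
lemma exists_edgeCount_ge (G : SimpleGraph (Fin n)) (a b : ℝ) {j : ℕ}
    (hlow : (lowDegree n G a).ncard ≤ j) (hj : j ≤ (peel n G a b).ncard) :
    ∃ W : Set (Fin n), W.ncard = j ∧
      b * (j - (lowDegree n G a).ncard) ≤ edgeCount G W := by
  suffices h : ∃ W : Set (Fin n), W.ncard = j ∧ lowDegree n G a ⊆ W ∧ W ⊆ peel n G a b ∧
      b * (j - (lowDegree n G a).ncard) ≤ edgeCount G W by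
    obtain ⟨W, h1, -, -, h2⟩ := h
    exact ⟨W, h1, h2⟩
  induction j, hlow using Nat.le_induction with
  | base => exact ⟨_, rfl, subset_rfl, lowDegree_subset_peel G a b, by simp⟩
  | succ j hlow ih =>
    obtain ⟨W, hcard, hlowW, hW, hedge⟩ := ih (by omega)
    have hv : ∃ v, b < ({w : Fin n | G.Adj v w ∧ w ∈ W}.ncard : ℝ) ∧ v ∉ W := by
      by_contra! h
      have := Set.ncard_le_ncard (peel_subset hlowW h) (Set.toFinite _)
      omega
    obtain ⟨v, hbv, hvW⟩ := hv
    refine ⟨insert v W, by rw [Set.ncard_insert_of_notMem hvW (Set.toFinite _), hcard],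
      hlowW.trans (Set.subset_insert _ _), Set.insert_subset ?_ hW, ?_⟩
    · refine mem_peel_of_lt (hbv.trans_le ?_)
      refine Nat.cast_le.2 (Set.ncard_le_ncard (fun w hw => ?_) (Set.toFinite _))
      exact ⟨hw.1, hW hw.2⟩
    · have := edgeCount_insert_le G hvW
      have h2 : (edgeCount G W : ℝ) + ({w | G.Adj v w ∧ w ∈ W}.ncard : ℝ) ≤
        edgeCount G (insert v W) := by exact_mod_cast this
      push_cast
      linarith

end Peeling

lemma plantedGraph_adj {n : ℕ} {ω : BichromPair n → Bool} {v w : Fin n} :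
    (plantedGraph n ω).Adj v w ↔ ∃ h : Bichrom n s(v, w), ω ⟨s(v, w), h⟩ = true := by
  rw [plantedGraph, SimpleGraph.fromEdgeSet_adj]
  refine ⟨fun h => h.1, fun h => ⟨h, ?_⟩⟩
  rintro rfl
  obtain ⟨h, -⟩ := h
  exact h rfl

section Cycles

variable {n k : ℕ}

open Classical in
/-- The bichromatic pairs on the closed walk through the vertices `f 0, f 1, …`. -/
noncomputable def cyclePairs (f : Fin (k + 3) → Fin n) : Finset (BichromPair n) :=
  Finset.univ.filter fun e => ∃ i, e.1 = s(f i, f (i + 1))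

lemma mem_cyclePairs {f : Fin (k + 3) → Fin n} {e : BichromPair n} :
    e ∈ cyclePairs f ↔ ∃ i, e.1 = s(f i, f (i + 1)) := by
  simp [cyclePairs]

lemma card_cyclePairs {f : Fin (k + 3) → Fin n} (hf : Function.Injective f)
    (hb : ∀ i, Bichrom n s(f i, f (i + 1))) : (cyclePairs f).card = k + 3 := by
  classical
  have h : cyclePairs f = Finset.univ.image fun i => ⟨s(f i, f (i + 1)), hb i⟩ := by
    ext ⟨e, he⟩
    simp [mem_cyclePairs, eq_comm]
  rw [h, Finset.card_image_of_injective, Finset.card_univ, Fintype.card_fin]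
  intro i j hij
  rw [Subtype.mk.injEq, Sym2.eq_iff, hf.eq_iff, hf.eq_iff, hf.eq_iff, hf.eq_iff] at hij
  rcases hij with h | ⟨h1, h2⟩
  · exact h.1
  · rw [h1, add_assoc, add_eq_left] at h2
    exfalso
    have := congrArg Fin.val h2
    simp [Fin.val_add, Nat.mod_eq_of_lt] at this

lemma ncard_adj_le_of_eq_off_cyclePairs {f : Fin (k + 3) → Fin n} (hf : Function.Injective f)
    {ω ω' : BichromPair n → Bool} (h : ∀ e, e ∉ cyclePairs f → ω e = ω' e) (v : Fin n)
    (X : Set (Fin n)) :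
    ({w | (plantedGraph n ω).Adj v w ∧ w ∈ X}.ncard : ℝ) ≤
      {w | (plantedGraph n ω').Adj v w ∧ w ∈ X}.ncard + 2 := by
  have hC : {w | ∃ i, s(v, w) = s(f i, f (i + 1))}.ncard ≤ 2 := by
    by_cases hv : ∃ j, f j = v
    · obtain ⟨j, rfl⟩ := hv
      refine (Set.ncard_le_ncard (t := {f (j + 1), f (j - 1)}) ?_ (Set.toFinite _)).trans
        (Set.ncard_insert_le _ _ |>.trans (by simp))
      rintro w ⟨i, hi⟩
      rcases Sym2.eq_iff.1 hi with ⟨h1, h2⟩ | ⟨h1, h2⟩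
      · exact Or.inl (by rw [h2, hf h1])
      · refine Or.inr ?_
        rw [Set.mem_singleton_iff, h2, hf h1, add_sub_cancel_right]
    · convert Nat.zero_le 2
      rw [Set.ncard_eq_zero (Set.toFinite _), Set.eq_empty_iff_forall_notMem]
      rintro w ⟨i, hi⟩
      rcases Sym2.eq_iff.1 hi with ⟨h1, h2⟩ | ⟨h1, h2⟩
      · exact hv ⟨_, h1.symm⟩
      · exact hv ⟨_, h1.symm⟩
  have hsub : {w | (plantedGraph n ω).Adj v w ∧ w ∈ X} ⊆
      {w | (plantedGraph n ω').Adj v w ∧ w ∈ X} ∪ {w | ∃ i, s(v, w) = s(f i, f (i + 1))} := by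
    rintro w ⟨hadj, hw⟩
    by_cases hi : ∃ i, s(v, w) = s(f i, f (i + 1))
    · exact Or.inr hi
    · obtain ⟨hb, hω⟩ := plantedGraph_adj.1 hadj
      refine Or.inl ⟨plantedGraph_adj.2 ⟨hb, ?_⟩, hw⟩
      rw [← h _ (fun hm => hi (mem_cyclePairs.1 hm)), hω]
  have := (Set.ncard_le_ncard hsub (Set.toFinite _)).trans (Set.ncard_union_le _ _)
  have h2 := this.trans (Nat.add_le_add_left hC _)
  exact_mod_cast h2

lemma exists_cycle_of_not_isAcyclic_induce {V : Type*} {G : SimpleGraph V} {S : Set V}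
    (h : ¬ (SimpleGraph.induce S G).IsAcyclic) :
    ∃ k, ∃ f : Fin (k + 3) → V, Function.Injective f ∧ (∀ i, f i ∈ S) ∧
      ∀ i, G.Adj (f i) (f (i + 1)) := by
  rw [SimpleGraph.isAcyclic_iff_free_cycleGraph] at h
  push Not at h
  obtain ⟨m, hm, hfree⟩ := h
  obtain ⟨k, rfl⟩ := Nat.exists_eq_add_of_le' hm
  obtain ⟨c⟩ := hfree
  refine ⟨k, fun i => (c i).1, fun i j hij => c.injective (Subtype.ext hij), fun i => (c i).2,
    fun i => ?_⟩
  have hadj : (SimpleGraph.cycleGraph (k + 3)).Adj i (i + 1) := by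
    rw [SimpleGraph.cycleGraph_adj]
    simp
  exact c.toHom.map_adj hadj

end Cycles

section Estimates

variable {n : ℕ} {p : ℝ}

lemma card_plantedColoring_eq (h3 : 3 ∣ n) (i : Fin 3) :
    3 * {w : Fin n | plantedColoring n w = i}.ncard = n := by
  obtain ⟨m, rfl⟩ := h3
  have h : {w : Fin (3 * m) | plantedColoring (3 * m) w = i} =
      Set.range fun j : Fin m => (⟨3 * j.1 + i.1, by omega⟩ : Fin (3 * m)) := by
    ext w
    simp only [Set.mem_ofPred_eq, Set.mem_range, plantedColoring, Fin.ext_iff]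
    refine ⟨fun h => ⟨⟨w.1 / 3, by omega⟩, by simp only; omega⟩, ?_⟩
    rintro ⟨j, hj⟩
    omega
  have hinj : Function.Injective fun j : Fin m => (⟨3 * j.1 + i.1, by omega⟩ : Fin (3 * m)) := by
    intro j j' h
    simp only [Fin.mk.injEq] at h
    omega
  rw [h, ← Set.image_univ, Set.ncard_image_of_injective _ hinj, Set.ncard_univ, Nat.card_fin]

lemma bernoulliProb_colorDegree_lt (h3 : 3 ∣ n) (h0 : 0 ≤ p) (h1 : p ≤ 1) (v : Fin n) {i : Fin 3}
    (hi : i ≠ plantedColoring n v) :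
    bernoulliProb p {ω : BichromPair n → Bool |
      ({w | (plantedGraph n ω).Adj v w ∧ plantedColoring n w = i}.ncard : ℝ) < 0.27 * (n * p)} ≤
      Real.exp (-(0.003 * (n * p))) := by
  classical
  have hb : ∀ w, plantedColoring n w = i → Bichrom n s(v, w) :=
    fun w hw h => hi (hw.symm.trans h.symm)
  set F : Finset (BichromPair n) :=
    Finset.univ.filter fun e => ∃ w, plantedColoring n w = i ∧ e.1 = s(v, w) with hF
  have hcount : ∀ (Q : BichromPair n → Prop) [DecidablePred Q], (F.filter Q).card =
      {w | plantedColoring n w = i ∧ ∃ h, Q ⟨s(v, w), h⟩}.ncard := by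
    intro Q _
    rw [← Set.ncard_coe_finset]
    symm
    refine Set.ncard_congr (fun w hw => ⟨s(v, w), hb w hw.1⟩) ?_ ?_ ?_
    · rintro w ⟨hw, h, hQ⟩
      simp only [Finset.coe_filter, Set.mem_ofPred_eq, hF, Finset.mem_filter, Finset.mem_univ,
        true_and]
      exact ⟨⟨w, hw, rfl⟩, hQ⟩
    · intro w w' _ _ h
      rcases Sym2.eq_iff.1 (Subtype.ext_iff.1 h) with h | h
      exacts [h.2, h.2.trans h.1]
    · rintro ⟨e, he⟩ hm
      simp only [Finset.coe_filter, Set.mem_ofPred_eq, hF, Finset.mem_filter, Finset.mem_univ,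
        true_and] at hm
      obtain ⟨⟨w, hw, rfl⟩, hQ⟩ := hm
      exact ⟨w, ⟨hw, he, hQ⟩, rfl⟩
  have hFcard : (F.card : ℝ) = n / 3 := by
    have h := hcount fun _ => True
    rw [Finset.filter_true] at h
    have h' : {w | plantedColoring n w = i ∧ ∃ _ : Bichrom n s(v, w), True} =
        {w | plantedColoring n w = i} := by
      ext w
      exact ⟨fun h => h.1, fun h => ⟨h, hb w h, trivial⟩⟩
    rw [h'] at h
    have h2 := card_plantedColoring_eq h3 i
    rw [← h] at h2
    rw [eq_div_iff (by norm_num), mul_comm]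
    exact_mod_cast h2
  have hdeg : ∀ ω : BichromPair n → Bool,
      {w | (plantedGraph n ω).Adj v w ∧ plantedColoring n w = i}.ncard =
        (F.filter fun e => ω e = true).card := by
    intro ω
    rw [hcount]
    congr 1
    ext w
    simp only [Set.mem_ofPred_eq, plantedGraph_adj]
    tauto
  refine (bernoulliProb_le_exp h0 h1 F (-0.1) (0.27 * (n * p)) fun ω hω => ?_).trans ?_
  · rw [Set.mem_ofPred_eq, hdeg] at hω
    linarith
  · rw [hFcard]
    refine Real.exp_le_exp.2 ?_
    have hexp : Real.exp (-0.1) ≤ 10 / 11 := by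
      have h := Real.add_one_le_exp (0.1 : ℝ)
      rw [Real.exp_neg, inv_le_comm₀ (Real.exp_pos _) (by norm_num)]
      linarith
    have hnp : 0 ≤ n * p := by positivity
    nlinarith

lemma bernoulliProb_lowDegree (h3 : 3 ∣ n) (hn : 0 < n) (h0 : 0 ≤ p) (h1 : p ≤ 1) {ε : ℝ}
    (hε : 0 < ε) :
    bernoulliProb p {ω : BichromPair n → Bool |
      ε * n / 2 < ((lowDegree n (plantedGraph n ω) (0.27 * (n * p))).ncard : ℝ)} ≤
      6 / ε * Real.exp (-(0.003 * (n * p))) := by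
  classical
  set s : Finset (Fin n × Fin 3) := Finset.univ.filter fun x => x.2 ≠ plantedColoring n x.1
  set A : Fin n × Fin 3 → Set (BichromPair n → Bool) := fun x => {ω |
    ({w | (plantedGraph n ω).Adj x.1 w ∧ plantedColoring n w = x.2}.ncard : ℝ) < 0.27 * (n * p)}
  have hle : ∀ ω, ((lowDegree n (plantedGraph n ω) (0.27 * (n * p))).ncard : ℝ) ≤
      ∑ x ∈ s, (A x).indicator (1 : (BichromPair n → Bool) → ℝ) ω := by
    intro ω
    have hsub : lowDegree n (plantedGraph n ω) (0.27 * (n * p)) ⊆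
        ((s.filter fun x => ω ∈ A x).image Prod.fst : Finset (Fin n)) := by
      rintro v ⟨i, hi, hlt⟩
      rw [Finset.mem_coe, Finset.mem_image]
      exact ⟨(v, i), by simpa [s, A] using ⟨hi, hlt⟩, rfl⟩
    have h := (Set.ncard_le_ncard hsub (Set.toFinite _)).trans
      ((Set.ncard_coe_finset _).le.trans Finset.card_image_le)
    have h2 : ∑ x ∈ s, (A x).indicator (1 : (BichromPair n → Bool) → ℝ) ω =
        ((s.filter fun x => ω ∈ A x).card : ℝ) := by
      simp [Set.indicator_apply]
    rw [h2]
    exact_mod_cast h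
  have hmarkov := mul_bernoulliProb_le_expect h0 h1
    (f := fun ω => ∑ x ∈ s, (A x).indicator (1 : (BichromPair n → Bool) → ℝ) ω)
    (fun ω => (Nat.cast_nonneg _).trans (hle ω)) (ε * n / 2)
    (A := {ω | ε * n / 2 < ((lowDegree n (plantedGraph n ω) (0.27 * (n * p))).ncard : ℝ)})
    (fun ω hω => hω.le.trans (hle ω))
  rw [bernoulliExpect_sum] at hmarkov
  have hsum : ∑ x ∈ s, bernoulliExpect p ((A x).indicator 1) ≤
      3 * n * Real.exp (-(0.003 * (n * p))) := by
    calc ∑ x ∈ s, bernoulliExpect p ((A x).indicator 1)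
        ≤ ∑ _x ∈ s, Real.exp (-(0.003 * (n * p))) :=
          Finset.sum_le_sum fun x hx =>
            bernoulliProb_colorDegree_lt h3 h0 h1 x.1 (by simpa [s] using hx)
      _ = s.card * Real.exp (-(0.003 * (n * p))) := by rw [Finset.sum_const, nsmul_eq_mul]
      _ ≤ 3 * n * Real.exp (-(0.003 * (n * p))) := by
          gcongr
          have := Finset.card_le_univ s
          rw [Fintype.card_prod, Fintype.card_fin, Fintype.card_fin, mul_comm] at this
          exact_mod_cast this
  have hn' : (0 : ℝ) < n := by exact_mod_cast hn
  have h := hmarkov.trans hsum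
  rw [div_mul_eq_mul_div, le_div_iff₀ hε]
  refine le_of_mul_le_mul_left ?_ hn'
  linarith

lemma choose_le_exp {m n : ℕ} (hm : 0 < m) (hn : 0 < n) :
    (n.choose m : ℝ) ≤ Real.exp (m * (1 + Real.log (n / m))) := by
  have hm' : (0 : ℝ) < m := by exact_mod_cast hm
  have hn' : (0 : ℝ) < n := by exact_mod_cast hn
  have h1 : (n.choose m : ℝ) ≤ (n : ℝ) ^ m / m.factorial := Nat.choose_le_pow_div m n
  have h2 : (m : ℝ) ^ m / m.factorial ≤ Real.exp m := Real.pow_div_factorial_le_exp m hm'.le m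
  calc (n.choose m : ℝ) ≤ (n : ℝ) ^ m / m.factorial := h1
    _ = (n / m : ℝ) ^ m * ((m : ℝ) ^ m / m.factorial) := by
      rw [div_pow]
      field_simp
    _ ≤ (n / m : ℝ) ^ m * Real.exp m := by gcongr
    _ = Real.exp (m * (1 + Real.log (n / m))) := by
      rw [mul_add, mul_one, Real.exp_add, Real.exp_nat_mul (Real.log _), Real.exp_log (by positivity),
        mul_comm]

lemma bernoulliProb_edgeCount_ge (h0 : 0 ≤ p) (h1 : p ≤ 1) {t : ℝ} (ht : 0 ≤ t) (r : ℝ)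
    (W : Set (Fin n)) :
    bernoulliProb p {ω : BichromPair n → Bool | r ≤ edgeCount (plantedGraph n ω) W} ≤
      Real.exp (-(t * r) + p * Real.exp t * (W.ncard : ℝ) ^ 2) := by
  classical
  set F : Finset (BichromPair n) := Finset.univ.filter fun e => ∀ v ∈ e.1, v ∈ W with hF
  have hFcard : F.card ≤ W.ncard ^ 2 := by
    have hsub : F.image Subtype.val ⊆ W.toFinset.sym2 := by
      intro e he
      obtain ⟨e', he', rfl⟩ := Finset.mem_image.1 he
      rw [Finset.mem_sym2_iff]
      intro v hv
      simpa using (Finset.mem_filter.1 he').2 v hv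
    have h := Finset.card_le_card hsub
    rw [Finset.card_image_of_injective _ Subtype.val_injective, Finset.card_sym2,
      ← Set.ncard_eq_toFinset_card'] at h
    refine h.trans ?_
    rw [Nat.choose_two_right, Nat.add_sub_cancel]
    refine Nat.div_le_of_le_mul ?_
    nlinarith [Nat.zero_le W.ncard, Nat.le_self_pow two_ne_zero W.ncard]
  have hedge : ∀ ω : BichromPair n → Bool,
      edgeCount (plantedGraph n ω) W ≤ (F.filter fun e => ω e = true).card := by
    intro ω
    have hsub : {e | e ∈ (plantedGraph n ω).edgeSet ∧ ∀ v ∈ e, v ∈ W} ⊆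
        ((F.filter fun e => ω e = true).image Subtype.val : Finset (Sym2 (Fin n))) := by
      rintro e ⟨he, hW⟩
      induction e using Sym2.ind with
      | _ v w =>
        obtain ⟨hb, hω⟩ := plantedGraph_adj.1 he
        rw [Finset.mem_coe, Finset.mem_image]
        exact ⟨⟨s(v, w), hb⟩, by simpa [hF] using ⟨by simpa using hW, hω⟩, rfl⟩
    exact (Set.ncard_le_ncard hsub (Set.toFinite _)).trans
      ((Set.ncard_coe_finset _).le.trans Finset.card_image_le)
  refine (bernoulliProb_le_exp h0 h1 F t r fun ω hω => ?_).trans ?_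
  · refine mul_le_mul_of_nonneg_left (le_trans hω ?_) ht
    exact_mod_cast hedge ω
  · refine Real.exp_le_exp.2 (add_le_add_right ?_ _)
    have h2 : (F.card : ℝ) ≤ (W.ncard : ℝ) ^ 2 := by exact_mod_cast hFcard
    have h3 : 0 ≤ Real.exp t - 1 := by linarith [Real.add_one_le_exp t]
    gcongr
    linarith

lemma bernoulliProb_exists_dense (h0 : 0 ≤ p) (h1 : p ≤ 1) {m : ℕ} (hm : 0 < m)
    (hmn : (m : ℝ) ≤ Real.exp (-150) * n) (hd : 1000 ≤ n * p) :
    bernoulliProb p {ω : BichromPair n → Bool | ∃ W : Set (Fin n), W.ncard = m ∧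
      0.02 * (n * p) * m ≤ edgeCount (plantedGraph n ω) W} ≤ Real.exp (-(n * p)) := by
  classical
  have hm' : (1 : ℝ) ≤ m := by exact_mod_cast hm
  have hn' : (0 : ℝ) < n := by
    by_contra! h
    nlinarith
  have hn : 0 < n := by exact_mod_cast hn'
  set L : ℝ := Real.log (n / m) with hL
  have hexpL : Real.exp L = n / m := Real.exp_log (by positivity)
  have hL150 : 150 ≤ L := by
    rw [hL, Real.le_log_iff_exp_le (by positivity), le_div_iff₀ (by positivity)]
    rw [Real.exp_neg, ← div_eq_inv_mul, le_div_iff₀ (Real.exp_pos _)] at hmn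
    linarith
  have hunion := bernoulliProb_iUnion_le h0 h1 (Finset.univ.powersetCard m)
    (fun W : Finset (Fin n) => {ω : BichromPair n → Bool |
      0.02 * (n * p) * m ≤ edgeCount (plantedGraph n ω) W})
  refine (bernoulliProb_mono h0 h1 ?_).trans (hunion.trans ?_)
  · rintro ω ⟨W, hW, hedge⟩
    refine ⟨W.toFinset, ?_, by simpa using hedge⟩
    rw [Finset.mem_powersetCard]
    exact ⟨Finset.subset_univ _, by rw [← Set.ncard_eq_toFinset_card', hW]⟩
  · calc _ ≤ ∑ W ∈ (Finset.univ : Finset (Fin n)).powersetCard m,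
          Real.exp (-(L * (0.02 * (n * p) * m)) + n * p * m) := by
          refine Finset.sum_le_sum fun W hW => ?_
          refine (bernoulliProb_edgeCount_ge h0 h1 (by linarith : 0 ≤ L) _ _).trans_eq ?_
          rw [Set.ncard_coe_finset, (Finset.mem_powersetCard.1 hW).2, hexpL]
          congr 2
          field_simp
      _ = n.choose m * Real.exp (-(L * (0.02 * (n * p) * m)) + n * p * m) := by
          rw [Finset.sum_const, Finset.card_powersetCard, Finset.card_univ, Fintype.card_fin,
            nsmul_eq_mul]
      _ ≤ Real.exp (m * (1 + L)) * Real.exp (-(L * (0.02 * (n * p) * m)) + n * p * m) := by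
          gcongr
          exact choose_le_exp hm hn
      _ ≤ Real.exp (-(n * p)) := by
          rw [← Real.exp_add, Real.exp_le_exp]
          set d := n * p
          have h2 : 1 + L - 0.02 * L * d + d ≤ -d := by nlinarith
          nlinarith

lemma bernoulliProb_peel_large (h3 : 3 ∣ n) (h0 : 0 ≤ p) (h1 : p ≤ 1) {ε : ℝ} (hε : 0 < ε)
    (hεn : ε * n + 1 ≤ Real.exp (-150) * n) (hd : 1000 ≤ n * p) :
    bernoulliProb p {ω : BichromPair n → Bool |
      ε * n < ((peel n (plantedGraph n ω) (n * p / 4 + 4) (n * p / 20 - 4)).ncard : ℝ)} ≤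
      6 / ε * Real.exp (-(0.003 * (n * p))) + Real.exp (-(n * p)) := by
  have hn' : (0 : ℝ) < n := by
    by_contra! h
    nlinarith
  have hεn0 : 0 ≤ ε * n := by positivity
  have hfloor := Nat.lt_floor_add_one (ε * n)
  have hfloor' := Nat.floor_le hεn0
  refine (bernoulliProb_mono h0 h1 ?_).trans ((bernoulliProb_union_le h0 h1 _ _).trans
    (add_le_add (bernoulliProb_lowDegree h3 (by exact_mod_cast hn') h0 h1 hε)
    (bernoulliProb_exists_dense h0 h1 (Nat.succ_pos ⌊ε * n⌋₊) (by push_cast; linarith) hd)))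
  intro ω hω
  rw [Set.mem_ofPred_eq] at hω
  by_cases hlow : ε * n / 2 < ((lowDegree n (plantedGraph n ω) (0.27 * (n * p))).ncard : ℝ)
  · exact Or.inl hlow
  · refine Or.inr ?_
    have hlow' : ((lowDegree n (plantedGraph n ω) (n * p / 4 + 4)).ncard : ℝ) ≤ ε * n / 2 := by
      refine le_trans ?_ (not_lt.1 hlow)
      exact_mod_cast Set.ncard_le_ncard (lowDegree_mono _ (by linarith)) (Set.toFinite _)
    obtain ⟨W, hW, hedge⟩ := exists_edgeCount_ge (plantedGraph n ω) (n * p / 4 + 4)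
      (n * p / 20 - 4) (j := ⌊ε * n⌋₊ + 1)
      (by
        have : ((lowDegree n (plantedGraph n ω) (n * p / 4 + 4)).ncard : ℝ) ≤
          ((⌊ε * n⌋₊ + 1 : ℕ) : ℝ) := by push_cast; linarith
        exact_mod_cast this)
      ((Nat.floor_lt hεn0).2 hω)
    refine ⟨W, hW, le_trans ?_ hedge⟩
    push_cast
    nlinarith

end Estimates

section CycleEstimates

variable {n : ℕ} {p : ℝ}

lemma sum_bernoulliProb_forall_mem_le {ι V : Type*} [Fintype ι] [DecidableEq ι] [Fintype V]
    (h0 : 0 ≤ p) (h1 : p ≤ 1) (k : ℕ) {M : ℝ} (hM : 0 ≤ M) (U : (ι → Bool) → Set V) :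
    ∑ f : Fin k → V, bernoulliProb p {ω | (∀ i, f i ∈ U ω) ∧ ((U ω).ncard : ℝ) ≤ M} ≤ M ^ k := by
  classical
  have hconst : bernoulliExpect p (fun _ : ι → Bool => M ^ k) = M ^ k := by
    have h := bernoulliExpect_const_mul p (M ^ k) (fun _ : ι → Bool => (1 : ℝ))
    simpa only [mul_one, bernoulliExpect_one] using h
  rw [← hconst]
  simp only [bernoulliProb]
  rw [← bernoulliExpect_sum]
  refine bernoulliExpect_mono h0 h1 fun ω => ?_
  by_cases hU : ((U ω).ncard : ℝ) ≤ M
  · have hfilter : (Finset.univ.filter fun f : Fin k → V => ∀ i, f i ∈ U ω) =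
        Fintype.piFinset fun _ => (U ω).toFinset := by
      ext f
      simp
    calc _ = ((Finset.univ.filter fun f : Fin k → V => ∀ i, f i ∈ U ω).card : ℝ) := by
          simp [Set.indicator_apply, hU]
      _ = ((U ω).ncard : ℝ) ^ k := by
          rw [hfilter, Fintype.card_piFinset_const, ← Set.ncard_eq_toFinset_card', Nat.cast_pow]
      _ ≤ M ^ k := by gcongr
  · refine (Finset.sum_nonpos fun f _ => ?_).trans (pow_nonneg hM k)
    simp [hU]

lemma bernoulliProb_cycle_le (h0 : 0 ≤ p) (h1 : p ≤ 1) {k : ℕ} (f : Fin (k + 3) → Fin n)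
    (a b M : ℝ) :
    bernoulliProb p {ω : BichromPair n → Bool | Function.Injective f ∧
      (∀ i, f i ∈ peel n (plantedGraph n ω) a b) ∧
      (∀ i, (plantedGraph n ω).Adj (f i) (f (i + 1))) ∧
      ((peel n (plantedGraph n ω) (a + 2 + 2) (b - 2 - 2)).ncard : ℝ) ≤ M} ≤
    p ^ (k + 3) * bernoulliProb p {ω : BichromPair n → Bool |
      (∀ i, f i ∈ peel n (plantedGraph n ω) (a + 2) (b - 2)) ∧
      ((peel n (plantedGraph n ω) (a + 2) (b - 2)).ncard : ℝ) ≤ M} := by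
  by_cases hf : Function.Injective f ∧ ∀ i, Bichrom n s(f i, f (i + 1))
  · obtain ⟨hf, hb⟩ := hf
    set B : Set (BichromPair n → Bool) := {ω | ∃ ω' : BichromPair n → Bool,
      (∀ e, e ∉ cyclePairs f → ω e = ω' e) ∧ (∀ i, f i ∈ peel n (plantedGraph n ω') a b) ∧
      ((peel n (plantedGraph n ω') (a + 2 + 2) (b - 2 - 2)).ncard : ℝ) ≤ M} with hB
    have hBinv : ∀ ω ω', (∀ e, e ∉ cyclePairs f → ω e = ω' e) → ω ∈ B → ω' ∈ B := by
      rintro ω ω' h ⟨η, hη, hη'⟩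
      exact ⟨η, fun e he => (h e he).symm.trans (hη e he), hη'⟩
    have hprob := bernoulliProb_inter_forall_true (p := p) (cyclePairs f) hBinv
    rw [card_cyclePairs hf hb] at hprob
    refine (bernoulliProb_mono h0 h1 ?_).trans (hprob.le.trans
      (mul_le_mul_of_nonneg_left (bernoulliProb_mono h0 h1 ?_) (by positivity)))
    · rintro ω ⟨-, hmem, hadj, hM⟩
      refine ⟨⟨ω, fun _ _ => rfl, hmem, hM⟩, fun e he => ?_⟩
      obtain ⟨i, hi⟩ := mem_cyclePairs.1 he
      obtain ⟨h, hω⟩ := plantedGraph_adj.1 (hadj i)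
      rwa [show e = ⟨s(f i, f (i + 1)), h⟩ from Subtype.ext hi]
    · rintro ω ⟨ω', hω, hmem, hM⟩
      have hclose := fun v X => ncard_adj_le_of_eq_off_cyclePairs hf hω v X
      have hclose' := fun v X =>
        ncard_adj_le_of_eq_off_cyclePairs hf (fun e he => (hω e he).symm) v X
      refine ⟨fun i => peel_subset_peel_of_close 2 hclose' hclose a b (hmem i), le_trans ?_ hM⟩
      exact_mod_cast Set.ncard_le_ncard
        (peel_subset_peel_of_close 2 hclose hclose' (a + 2) (b - 2)) (Set.toFinite _)
  · refine le_trans ?_ (mul_nonneg (by positivity) (bernoulliProb_nonneg h0 h1 _))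
    refine (bernoulliProb_mono h0 h1 (B := ∅) ?_).trans (by simp [bernoulliProb, bernoulliExpect])
    rintro ω ⟨hinj, -, hadj, -⟩
    exact hf ⟨hinj, fun i => (plantedGraph_adj.1 (hadj i)).1⟩

lemma bernoulliProb_not_isAcyclic_le (h0 : 0 ≤ p) (h1 : p ≤ 1) (a b : ℝ) {M : ℝ} (hM : 0 ≤ M)
    (hpM : p * M ≤ 1 / 2) :
    bernoulliProb p {ω : BichromPair n → Bool |
      ¬ (SimpleGraph.induce (peel n (plantedGraph n ω) a b) (plantedGraph n ω)).IsAcyclic ∧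
      ((peel n (plantedGraph n ω) (a + 2 + 2) (b - 2 - 2)).ncard : ℝ) ≤ M} ≤ p * M := by
  have hpM0 : 0 ≤ p * M := mul_nonneg h0 hM
  refine (bernoulliProb_mono h0 h1 ?_).trans ((bernoulliProb_iUnion_le h0 h1 (Finset.range n)
    (fun k => {ω : BichromPair n → Bool | ∃ f ∈ (Finset.univ : Finset (Fin (k + 3) → Fin n)),
      ω ∈ {ω : BichromPair n → Bool | Function.Injective f ∧
        (∀ i, f i ∈ peel n (plantedGraph n ω) a b) ∧
        (∀ i, (plantedGraph n ω).Adj (f i) (f (i + 1))) ∧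
        ((peel n (plantedGraph n ω) (a + 2 + 2) (b - 2 - 2)).ncard : ℝ) ≤ M}})).trans ?_)
  · rintro ω ⟨hcyc, hcard⟩
    obtain ⟨k, f, hf, hmem, hadj⟩ := exists_cycle_of_not_isAcyclic_induce hcyc
    have hk := Fintype.card_le_of_injective f hf
    rw [Fintype.card_fin, Fintype.card_fin] at hk
    exact ⟨k, Finset.mem_range.2 (by omega), f, Finset.mem_univ f, hf, hmem, hadj, hcard⟩
  · have hterm : ∀ k, ∑ f : Fin (k + 3) → Fin n,
        bernoulliProb p {ω : BichromPair n → Bool | Function.Injective f ∧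
          (∀ i, f i ∈ peel n (plantedGraph n ω) a b) ∧
          (∀ i, (plantedGraph n ω).Adj (f i) (f (i + 1))) ∧
          ((peel n (plantedGraph n ω) (a + 2 + 2) (b - 2 - 2)).ncard : ℝ) ≤ M} ≤
        (p * M) * ((1 / 2) * (1 / 2) ^ k) := by
      intro k
      refine (Finset.sum_le_sum fun f _ => bernoulliProb_cycle_le h0 h1 f a b M).trans ?_
      rw [← Finset.mul_sum]
      refine (mul_le_mul_of_nonneg_left (sum_bernoulliProb_forall_mem_le h0 h1 (k + 3) hM
        fun ω => peel n (plantedGraph n ω) (a + 2) (b - 2)) (by positivity)).trans ?_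
      rw [← mul_pow, pow_succ', ← pow_succ' (1 / 2 : ℝ)]
      refine mul_le_mul_of_nonneg_left ?_ hpM0
      calc (p * M) ^ (k + 2) ≤ (1 / 2) ^ (k + 2) := by gcongr
        _ ≤ (1 / 2) ^ (k + 1) := pow_le_pow_of_le_one (by norm_num) (by norm_num) (by omega)
    refine (Finset.sum_le_sum fun k _ =>
      (bernoulliProb_iUnion_le h0 h1 _ _).trans (hterm k)).trans ?_
    rw [← Finset.mul_sum, ← Finset.mul_sum]
    refine mul_le_of_le_one_right hpM0 ?_
    have := sum_geometric_two_le n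
    linarith

end CycleEstimates

/-- with probability `1 - e^{-c n p}` the planted graph admits a large
`(np)`-core whose complement induces a forest. -/
theorem exists_large_core_acyclic_complement :
    ∃ C0 c : ℝ, ∃ N : ℕ, 0 < C0 ∧ 0 < c ∧
      ∀ n : ℕ, N ≤ n → 3 ∣ n → ∀ p : ℝ, 0 ≤ p → p ≤ 1 → C0 ≤ n * p →
        ENNReal.ofReal (1 - Real.exp (-(c * n * p))) ≤
          plantedMeasure n p {ω : BichromPair n → Bool |
            ∃ D : Set (Fin n), IsCore n (plantedGraph n ω) (n * p) D ∧
              (1 - Real.exp (-(c * n * p))) * n ≤ (D.ncard : ℝ) ∧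
              (SimpleGraph.induce Dᶜ (plantedGraph n ω)).IsAcyclic} := by
  refine ⟨1000000, 0.0001, ⌈Real.exp 200⌉₊, by norm_num, by norm_num, ?_⟩
  intro n hN h3 p h0 h1 hd
  have hn200 : Real.exp 200 ≤ n := Nat.ceil_le.1 hN
  have hn' : (0 : ℝ) < n := (Real.exp_pos _).trans_le hn200
  set d : ℝ := n * p with hd_def
  set ε : ℝ := Real.exp (-(0.001 * d)) with hε_def
  have hε : 0 < ε := Real.exp_pos _
  rw [plantedMeasure_eq_ofReal h0 h1, mul_assoc]
  refine ENNReal.ofReal_le_ofReal ?_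
  rw [bernoulliProb_compl]
  have hεn : ε * n + 1 ≤ Real.exp (-150) * n := by
    have h : ε ≤ Real.exp (-151) := Real.exp_le_exp.2 (by linarith)
    have h' : 1 ≤ Real.exp (-151) * n := by
      have : Real.exp (-151) * Real.exp 200 ≤ Real.exp (-151) * n := by gcongr
      rw [← Real.exp_add] at this
      exact (Real.one_le_exp (by norm_num)).trans this
    have h'' : 2 * Real.exp (-151) ≤ Real.exp (-150) := by
      have h2 : (-150 : ℝ) = 1 + -151 := by norm_num
      have h1 := Real.add_one_le_exp 1
      rw [h2, Real.exp_add]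
      nlinarith [Real.exp_pos (-151)]
    have : ε * n ≤ Real.exp (-151) * n := by gcongr
    nlinarith
  have hdε : d * ε ≤ 2000 * Real.exp (-(0.0005 * d)) := by
    have h : d ≤ 2000 * Real.exp (0.0005 * d) := by
      linarith [Real.add_one_le_exp (0.0005 * d)]
    have hsplit : Real.exp (0.0005 * d) * ε = Real.exp (-(0.0005 * d)) := by
      rw [hε_def, ← Real.exp_add]
      congr 1
      ring
    calc d * ε ≤ 2000 * Real.exp (0.0005 * d) * ε := by gcongr
      _ = 2000 * Real.exp (-(0.0005 * d)) := by rw [mul_assoc, hsplit]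
  have hsmall : 10000 * Real.exp (-(0.0005 * d)) ≤ Real.exp (-(0.0001 * d)) := by
    have h : (10000 : ℝ) ≤ Real.exp (0.0004 * d) := by
      have h2 : (100 : ℝ) ≤ Real.exp (0.0002 * d) := by
        linarith [Real.add_one_le_exp (0.0002 * d)]
      have h3 : Real.exp (0.0004 * d) = Real.exp (0.0002 * d) * Real.exp (0.0002 * d) := by
        rw [← Real.exp_add]
        congr 1
        ring
      nlinarith
    calc 10000 * Real.exp (-(0.0005 * d)) ≤ Real.exp (0.0004 * d) * Real.exp (-(0.0005 * d)) := by
          gcongr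
      _ = Real.exp (-(0.0001 * d)) := by
          rw [← Real.exp_add]
          congr 1
          ring
  have hexp1 : Real.exp (-(0.0001 * d)) ≤ 1 := Real.exp_le_one_iff.2 (by linarith)
  have hpM : p * (ε * n) = d * ε := by rw [hd_def]; ring
  have hpeel := bernoulliProb_peel_large h3 h0 h1 hε hεn (by linarith)
  have hcycle := bernoulliProb_not_isAcyclic_le (n := n) h0 h1 (d / 4) (d / 20) (M := ε * n)
    (by positivity) (by linarith)
  rw [show d / 4 + 2 + 2 = d / 4 + 4 by ring, show d / 20 - 2 - 2 = d / 20 - 4 by ring,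
    hpM] at hcycle
  have hbad : 6 / ε * Real.exp (-(0.003 * d)) + Real.exp (-d) + d * ε ≤
      Real.exp (-(0.0001 * d)) := by
    have h1 : 6 / ε * Real.exp (-(0.003 * d)) = 6 * Real.exp (-(0.002 * d)) := by
      rw [hε_def, Real.exp_neg (0.001 * d), div_inv_eq_mul, mul_assoc, ← Real.exp_add]
      congr 2
      ring
    have h2 : Real.exp (-(0.002 * d)) ≤ Real.exp (-(0.0005 * d)) :=
      Real.exp_le_exp.2 (by linarith)
    have h3 : Real.exp (-d) ≤ Real.exp (-(0.0005 * d)) := Real.exp_le_exp.2 (by linarith)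
    linarith [Real.exp_pos (-(0.0005 * d))]
  refine sub_le_sub_left (le_trans ?_ hbad) _
  refine (bernoulliProb_mono h0 h1 ?_).trans ((bernoulliProb_union_le h0 h1 _ _).trans
    (add_le_add hpeel hcycle))
  intro ω hω
  by_contra hgood
  rw [Set.mem_union, not_or] at hgood
  obtain ⟨hlarge, hacyc⟩ := hgood
  rw [Set.mem_ofPred_eq, not_lt] at hlarge
  have hacyc' : (SimpleGraph.induce (peel n (plantedGraph n ω) (d / 4) (d / 20))
      (plantedGraph n ω)).IsAcyclic := by
    by_contra h
    exact hacyc ⟨h, hlarge⟩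
  refine hω ⟨(peel n (plantedGraph n ω) (d / 4) (d / 20))ᶜ, isCore_compl_peel _ _, ?_,
    by rwa [compl_compl]⟩
  have hsub : peel n (plantedGraph n ω) (d / 4) (d / 20) ⊆
      peel n (plantedGraph n ω) (d / 4 + 4) (d / 20 - 4) :=
    peel_subset_peel_of_close 4 (fun _ _ => by linarith) (fun _ _ => by linarith) _ _
  have hcard : ((peel n (plantedGraph n ω) (d / 4) (d / 20)).ncard : ℝ) ≤ ε * n :=
    le_trans (by exact_mod_cast Set.ncard_le_ncard hsub (Set.toFinite _)) hlarge
  have hcompl := Set.ncard_add_ncard_compl (peel n (plantedGraph n ω) (d / 4) (d / 20))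
  rw [Nat.card_fin] at hcompl
  have hcompl' : ((peel n (plantedGraph n ω) (d / 4) (d / 20)).ncard : ℝ) +
      ((peel n (plantedGraph n ω) (d / 4) (d / 20))ᶜ.ncard : ℝ) = n := by exact_mod_cast hcompl
  have hεle : ε ≤ Real.exp (-(0.0001 * d)) := Real.exp_le_exp.2 (by linarith)
  nlinarith
end
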